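/- arXiv:2307.10510 — 6 statements merged into one kernel-verified Lean document; each statement's English description precedes it below -/
import Mathlib

section
/- For all integers k, ℓ, x with 3 ≤ k < ℓ (and ℓ ≥ 5 in case k = 3) and 2 ≤ x ≤ k−1, there exists a (k, ℓ, x)-red-transmitter; that is, a (P_k, P_ℓ)-good graph G with a vertex v such that in every (P_k, P_ℓ)-good coloring of G, v is a strict endpoint of a red P_x and v is incident to no blue edge. -/
/-- `G` contains a path on `n` vertices (as a subgraph). -/
def HasNPath {V : Type*} (G : SimpleGraph V) (n : ℕ) : Prop :=
  ∃ (u w : V) (p : G.Walk u w), p.IsPath ∧ p.length + 1 = n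

/-- `v` is an endpoint of a path on `n` vertices in `G`. -/
def IsPathEndpoint {V : Type*} (G : SimpleGraph V) (v : V) (n : ℕ) : Prop :=
  ∃ (w : V) (p : G.Walk v w), p.IsPath ∧ p.length + 1 = n

/-- `x` is the maximum number of vertices of a path in `G` having `v` as an endpoint;
we then say `v` is a strict endpoint of a `P_x` in `G`. -/
def StrictEndpoint {V : Type*} (G : SimpleGraph V) (v : V) (x : ℕ) : Prop :=
  IsPathEndpoint G v x ∧ ∀ y, IsPathEndpoint G v y → y ≤ x

/-- A red/blue coloring of the edges of `G` is given by its red subgraph `R ≤ G`;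
the blue subgraph is `G \ R`.  The coloring is `(P_k, P_ℓ)`-good if the red subgraph
has no path on `k` vertices and the blue subgraph has no path on `ℓ` vertices. -/
def GoodColoring {V : Type*} (G R : SimpleGraph V) (k ℓ : ℕ) : Prop :=
  R ≤ G ∧ ¬ HasNPath R k ∧ ¬ HasNPath (G \ R) ℓ

/-- `G` is `(P_k, P_ℓ)`-good if it admits at least one `(P_k, P_ℓ)`-good coloring. -/
def IsGood {V : Type*} (G : SimpleGraph V) (k ℓ : ℕ) : Prop :=
  ∃ R : SimpleGraph V, GoodColoring G R k ℓ

open SimpleGraph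

section PathLists

variable {V W : Type*} {G H : SimpleGraph V}

/-- `l` lists the vertices of a path of `G` in order (possibly no vertices at all). -/
def IsPathList (G : SimpleGraph V) (l : List V) : Prop :=
  l.IsChain G.Adj ∧ l.Nodup

lemma isPathEndpoint_iff {v : V} {n : ℕ} :
    IsPathEndpoint G v n ↔ ∃ t : List V, t.length + 1 = n ∧ IsPathList G (v :: t) := by
  constructor
  · rintro ⟨w, p, hp, rfl⟩
    refine ⟨p.support.tail, by simp, ?_⟩
    rw [p.cons_tail_support]
    exact ⟨p.isChain_adj_support, hp.support_nodup⟩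
  · rintro ⟨t, rfl, hc, hn⟩
    obtain ⟨w, p, hp⟩ : ∃ w, ∃ p : G.Walk v w, p.support = v :: t :=
      ⟨_, Walk.ofSupport (v :: t) (by simp) hc, Walk.support_ofSupport _ _⟩
    refine ⟨w, p, p.isPath_def.2 (hp ▸ hn), ?_⟩
    rw [← Walk.length_support, hp, List.length_cons]

lemma IsPathList.hasNPath {l : List V} (h : IsPathList G l) (hl : l ≠ []) :
    HasNPath G l.length := by
  cases l with
  | nil => exact absurd rfl hl
  | cons v t => exact ⟨v, isPathEndpoint_iff.2 ⟨t, rfl, h⟩⟩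

lemma IsPathEndpoint.hasNPath {v : V} {n : ℕ} (h : IsPathEndpoint G v n) : HasNPath G n :=
  ⟨v, h⟩

lemma isPathEndpoint_one (v : V) : IsPathEndpoint G v 1 :=
  ⟨v, Walk.nil, Walk.IsPath.nil, rfl⟩

lemma IsPathEndpoint.of_le {v : V} {m n : ℕ} (h : IsPathEndpoint G v n) (hm : 1 ≤ m)
    (hmn : m ≤ n) : IsPathEndpoint G v m := by
  obtain ⟨t, rfl, hc, hn⟩ := isPathEndpoint_iff.1 h
  refine isPathEndpoint_iff.2 ⟨t.take (m - 1), by simp; omega, ?_⟩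
  have : v :: t.take (m - 1) = (v :: t).take m := by
    obtain ⟨m, rfl⟩ := Nat.exists_eq_add_of_le' hm
    simp
  rw [this]
  exact ⟨hc.take _, hn.sublist (List.take_sublist _ _)⟩

lemma HasNPath.of_le {m n : ℕ} (h : HasNPath G n) (hm : 1 ≤ m) (hmn : m ≤ n) : HasNPath G m :=
  let ⟨v, hv⟩ := h
  ⟨v, IsPathEndpoint.of_le hv hm hmn⟩

lemma IsPathEndpoint.map {H : SimpleGraph W} {v : V} {n : ℕ} (f : V → W)
    (hf : Function.Injective f) (hGH : ∀ a b, G.Adj a b → H.Adj (f a) (f b))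
    (h : IsPathEndpoint G v n) : IsPathEndpoint H (f v) n := by
  obtain ⟨t, rfl, hc, hn⟩ := isPathEndpoint_iff.1 h
  exact isPathEndpoint_iff.2 ⟨t.map f, by simp,
    by simpa using List.isChain_map_of_isChain f hGH hc, by simpa using hn.map hf⟩

lemma HasNPath.map {H : SimpleGraph W} {n : ℕ} (f : V → W)
    (hf : Function.Injective f) (hGH : ∀ a b, G.Adj a b → H.Adj (f a) (f b))
    (h : HasNPath G n) : HasNPath H n :=
  let ⟨_, hv⟩ := h
  (IsPathEndpoint.map f hf hGH hv).hasNPath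

lemma HasNPath.mono {n : ℕ} (hGH : G ≤ H) (h : HasNPath G n) : HasNPath H n :=
  h.map id Function.injective_id fun _ _ hab => hGH hab

/-- A path starting in a set closed under adjacency, on which `f` is injective and maps edges
to edges of `H`, is carried by `f` to a path of `H`. -/
lemma IsPathEndpoint.map_of_closed {H : SimpleGraph W} {v : V} {n : ℕ} (S : Set V) (f : V → W)
    (hv : v ∈ S) (hS : ∀ a ∈ S, ∀ b, G.Adj a b → b ∈ S ∧ H.Adj (f a) (f b))
    (hf : Set.InjOn f S) (h : IsPathEndpoint G v n) : IsPathEndpoint H (f v) n := by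
  obtain ⟨t, rfl, hc, hn⟩ := isPathEndpoint_iff.1 h
  have key : ∀ (t : List V) (v : V), v ∈ S → (v :: t).IsChain G.Adj →
      (∀ a ∈ v :: t, a ∈ S) ∧ ((v :: t).map f).IsChain H.Adj := by
    intro t
    induction t with
    | nil => intro v hv _; simp [hv]
    | cons w t ih =>
      intro v hv hc
      rw [List.isChain_cons_cons] at hc
      obtain ⟨hw, hadj⟩ := hS v hv w hc.1
      obtain ⟨h1, h2⟩ := ih w hw hc.2
      refine ⟨?_, ?_⟩
      · intro a ha
        rcases List.mem_cons.1 ha with rfl | ha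
        · exact hv
        · exact h1 a ha
      · simpa using ⟨hadj, by simpa using h2⟩
  obtain ⟨h1, h2⟩ := key t v hv hc
  refine isPathEndpoint_iff.2 ⟨t.map f, by simp, by simpa using h2, ?_⟩
  have := hn.map_on (f := f) fun a ha b hb hab => hf (h1 a ha) (h1 b hb) hab
  simpa using this

lemma HasNPath.le_card [Fintype V] {n : ℕ} (h : HasNPath G n) : n ≤ Fintype.card V := by
  obtain ⟨v, hv⟩ := h
  obtain ⟨t, rfl, -, hn⟩ := isPathEndpoint_iff.1 hv
  exact hn.length_le_card

lemma not_hasNPath_bot {n : ℕ} (hn : 2 ≤ n) : ¬ HasNPath (⊥ : SimpleGraph V) n := by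
  intro h
  obtain ⟨v, hv⟩ := h.of_le (by norm_num) hn
  obtain ⟨t, ht, hc, -⟩ := isPathEndpoint_iff.1 hv
  match t, ht with
  | [w], _ => simp at hc

/-- The vertices of a path alternate between a vertex cover and its complement at best. -/
lemma IsPathList.length_le_of_cover {l : List V} (h : IsPathList G l) (p : V → Prop)
    [DecidablePred p] (hp : ∀ a b, G.Adj a b → p a ∨ p b) :
    l.length ≤ 2 * l.countP (fun a => p a) + 1 ∧
      ∀ v ∈ l.head?, p v → l.length ≤ 2 * l.countP (fun a => p a) := by
  obtain ⟨hc, -⟩ := h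
  induction l with
  | nil => simp
  | cons a l ih =>
    have ih := ih hc.of_cons
    cases l with
    | nil => by_cases ha : p a <;> simp [ha]
    | cons b l =>
      have hab := hp a b (List.isChain_cons_cons.1 hc).1
      rw [List.countP_cons (a := a)]
      by_cases ha : p a
      · simp only [ha, decide_true, if_true, List.length_cons (a := a)]
        simp only [List.head?_cons, Option.mem_def, Option.some.injEq, forall_eq'] at ih ⊢
        omega
      · have hb : p b := by tauto
        simp only [List.head?_cons, Option.mem_def, Option.some.injEq, forall_eq', hb, ha,
          forall_const, List.length_cons (a := a), decide_false] at ih ⊢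
        simp
        simp at ih
        omega

lemma IsPathList.countP_le_card {l : List V} (h : IsPathList G l) (p : V → Prop)
    [DecidablePred p] (S : Finset W) (f : W → V) (hf : ∀ a, p a → ∃ s ∈ S, f s = a) :
    l.countP (fun a => p a) ≤ S.card := by
  classical
  rw [List.countP_eq_length_filter,
    ← List.toFinset_card_of_nodup (h.2.sublist List.filter_sublist)]
  refine (Finset.card_le_card ?_).trans (Finset.card_image_le (s := S) (f := f))
  intro a ha
  simp only [List.mem_toFinset, List.mem_filter, decide_eq_true_eq] at ha
  simpa using hf a ha.2

/-- A graph all of whose edges meet the image of `S` has no path on more than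
`2 * S.card + 1` vertices, and none on more than `2 * S.card` starting in the image. -/
lemma not_hasNPath_of_cover {n : ℕ} (S : Finset W) (f : W → V)
    (hS : ∀ a b, G.Adj a b → (∃ s ∈ S, f s = a) ∨ ∃ s ∈ S, f s = b)
    (hn : 2 * S.card + 1 < n) : ¬ HasNPath G n := by
  classical
  rintro ⟨v, hv⟩
  obtain ⟨t, rfl, ht⟩ := isPathEndpoint_iff.1 hv
  have h1 := (ht.length_le_of_cover (fun a => ∃ s ∈ S, f s = a) hS).1
  have h2 := ht.countP_le_card (fun a => ∃ s ∈ S, f s = a) S f fun _ h => h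
  simp only [List.length_cons] at h1 h2
  omega

lemma not_isPathEndpoint_of_cover {n : ℕ} (S : Finset W) (f : W → V)
    (hS : ∀ a b, G.Adj a b → (∃ s ∈ S, f s = a) ∨ ∃ s ∈ S, f s = b) {s : W} (hs : s ∈ S)
    (hn : 2 * S.card < n) : ¬ IsPathEndpoint G (f s) n := by
  classical
  intro hv
  obtain ⟨t, rfl, ht⟩ := isPathEndpoint_iff.1 hv
  have h1 := (ht.length_le_of_cover (fun a => ∃ s ∈ S, f s = a) hS).2 (f s) (by simp) ⟨s, hs, rfl⟩
  have h2 := ht.countP_le_card (fun a => ∃ s ∈ S, f s = a) S f fun _ h => h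
  simp only [List.length_cons] at h1 h2
  omega

lemma exists_alternating (ys ms : List V) (hlen : ys.length = ms.length)
    (hnd : (ys ++ ms).Nodup) (hadj : ∀ y ∈ ys, ∀ m ∈ ms, G.Adj y m) :
    ∃ l, IsPathList G l ∧ l.length = 2 * ys.length ∧ (∀ a ∈ l, a ∈ ys ∨ a ∈ ms) ∧
      l.head? = ys.head? := by
  induction ys generalizing ms with
  | nil => exact ⟨[], ⟨by simp, by simp⟩, by simp, by simp, rfl⟩
  | cons y ys ih =>
    cases ms with
    | nil => simp at hlen
    | cons m ms =>
      obtain ⟨l, hl, hlen', hmem, hhead⟩ := ih ms (by simpa using hlen) (by grind)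
        fun y hy m hm => hadj y (by simp [hy]) m (by simp [hm])
      refine ⟨y :: m :: l, ⟨?_, ?_⟩, by simp [hlen']; ring, by grind, by simp⟩
      · rw [List.isChain_cons_cons, List.isChain_cons]
        refine ⟨hadj y (by simp) m (by simp), ?_, hl.1⟩
        intro a ha
        rw [hhead] at ha
        exact (hadj a (List.mem_cons_of_mem _ (List.mem_of_mem_head? ha)) m (by simp)).symm
      · have := hl.2
        have h1 : y ∉ l := fun h => by grind
        have h2 : m ∉ l := fun h => by grind
        grind

/-- A complete bipartite subgraph contains a path alternating between its two sides. -/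
lemma isPathEndpoint_of_biclique (Y M : Finset V) (hadj : ∀ y ∈ Y, ∀ m ∈ M, G.Adj y m)
    (hYM : Y.card ≤ M.card) {y : V} (hy : y ∈ Y) : IsPathEndpoint G y (2 * Y.card) := by
  classical
  obtain ⟨M', hM', hcard⟩ := Finset.exists_subset_card_eq hYM
  have hdisj : Disjoint Y M' := Finset.disjoint_left.2 fun a ha ha' =>
    G.loopless.irrefl a (hadj a ha a (hM' ha'))
  obtain ⟨l, hl, hlen, -, hhead⟩ := exists_alternating (G := G) (y :: (Y.erase y).toList)
    M'.toList
    (by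
      have := Finset.card_pos.2 ⟨y, hy⟩
      simp [hcard, Finset.card_erase_of_mem hy]
      omega)
    (by
      have h1 := Finset.nodup_toList (Y.erase y)
      have h2 := Finset.nodup_toList M'
      have h3 : y ∉ M' := Finset.disjoint_left.1 hdisj hy
      simp only [List.cons_append, List.nodup_cons, List.mem_append, Finset.mem_toList,
        Finset.mem_erase, List.nodup_append', h1, h2, true_and]
      refine ⟨by simp [h3], ?_⟩
      intro a ha hb
      simp only [Finset.mem_toList, Finset.mem_erase] at ha hb
      exact Finset.disjoint_left.1 hdisj ha.2 hb)
    (by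
      intro a ha m hm
      simp only [List.mem_cons, Finset.mem_toList, Finset.mem_erase] at ha hm
      rcases ha with rfl | ha
      · exact hadj _ hy m (hM' hm)
      · exact hadj _ ha.2 m (hM' hm))
  cases l with
  | nil => simp at hlen
  | cons a t =>
    obtain rfl : a = y := by simpa using hhead
    refine isPathEndpoint_iff.2 ⟨t, ?_, hl⟩
    have := Finset.card_pos.2 ⟨a, hy⟩
    simp [Finset.card_erase_of_mem hy] at hlen
    omega

lemma hasNPath_of_biclique (Y M : Finset V) (hadj : ∀ y ∈ Y, ∀ m ∈ M, G.Adj y m)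
    (hYM : Y.card < M.card) : HasNPath G (2 * Y.card + 1) := by
  classical
  obtain ⟨m, hm⟩ := Finset.card_pos.1 (by omega : 0 < M.card)
  obtain ⟨M', hM', hcard⟩ := Finset.exists_subset_card_eq
    (show Y.card ≤ (M.erase m).card by rw [Finset.card_erase_of_mem hm]; omega)
  have hsub : ∀ a ∈ M', a ∈ M := fun a ha => Finset.mem_of_mem_erase (hM' ha)
  have hdisj : ∀ a ∈ Y, a ∉ M := fun a ha ha' => G.loopless.irrefl a (hadj a ha a ha')
  obtain ⟨l, hl, hlen, hmem, hhead⟩ := exists_alternating (G := G) Y.toList M'.toList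
    (by simp [hcard])
    (by
      simp only [List.nodup_append', Finset.nodup_toList, true_and]
      intro a ha hb
      simp only [Finset.mem_toList] at ha hb
      exact hdisj a ha (hsub a hb))
    (by simpa using fun a ha b hb => hadj a ha b (hsub b hb))
  have : IsPathList G (m :: l) := by
    refine ⟨List.isChain_cons.2 ⟨fun a ha => ?_, hl.1⟩, List.nodup_cons.2 ⟨fun h => ?_, hl.2⟩⟩
    · rw [hhead] at ha
      exact (hadj a (by simpa using List.mem_of_mem_head? ha) m hm).symm
    · rcases hmem m h with h | h
      · exact hdisj m (by simpa using h) hm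
      · exact Finset.notMem_erase m M (hM' (by simpa using h))
  simpa [hlen] using this.hasNPath (by simp)

end PathLists

section Gluing

variable {V ι : Type*}

/-- `(R, B)` is a cover of the edges of `G` by a red graph without a path on `k` vertices and a
blue graph without a path on `ℓ` vertices; an edge may have both colors. -/
structure IsGoodCover (G R B : SimpleGraph V) (k ℓ : ℕ) : Prop where
  sup_eq : R ⊔ B = G
  red : ¬ HasNPath R k
  blue : ¬ HasNPath B ℓ

namespace IsGoodCover

variable {G R B : SimpleGraph V} {k ℓ : ℕ}

lemma swap (h : IsGoodCover G R B k ℓ) : IsGoodCover G B R ℓ k :=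
  ⟨by rw [sup_comm, h.sup_eq], h.blue, h.red⟩

lemma red_le (h : IsGoodCover G R B k ℓ) : R ≤ G := h.sup_eq ▸ le_sup_left

lemma blue_le (h : IsGoodCover G R B k ℓ) : B ≤ G := h.sup_eq ▸ le_sup_right

lemma red_or_blue (h : IsGoodCover G R B k ℓ) {a b : V} (hab : G.Adj a b) :
    R.Adj a b ∨ B.Adj a b := by
  rw [← h.sup_eq] at hab
  exact hab

lemma comap {W : Type*} (h : IsGoodCover G R B k ℓ) {f : W → V} (hf : Function.Injective f) :
    IsGoodCover (G.comap f) (R.comap f) (B.comap f) k ℓ := by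
  refine ⟨?_, fun hp => h.red (hp.map f hf fun _ _ => id),
    fun hp => h.blue (hp.map f hf fun _ _ => id)⟩
  rw [← h.sup_eq]
  rfl

end IsGoodCover

/-- The disjoint union of the graphs `G i` with the copies of the vertex `v` joined
according to `F`. -/
def glue (F : SimpleGraph ι) (G : ι → SimpleGraph V) (v : V) : SimpleGraph (ι × V) where
  Adj a b := (a.1 = b.1 ∧ (G a.1).Adj a.2 b.2) ∨ (F.Adj a.1 b.1 ∧ a.2 = v ∧ b.2 = v)
  symm := ⟨by
    rintro ⟨i, x⟩ ⟨j, y⟩ (⟨h, h'⟩ | ⟨h, h'⟩)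
    · obtain rfl : i = j := h
      exact Or.inl ⟨rfl, h'.symm⟩
    · exact Or.inr ⟨h.symm, h'.symm⟩⟩
  loopless := ⟨by
    rintro ⟨i, x⟩ (⟨-, h⟩ | ⟨h, -⟩)
    · exact (G i).loopless.irrefl x h
    · exact F.loopless.irrefl i h⟩

section Glue

variable {F : SimpleGraph ι} {G : ι → SimpleGraph V} {v : V}

lemma glue_adj {a b : ι × V} : (glue F G v).Adj a b ↔
    (a.1 = b.1 ∧ (G a.1).Adj a.2 b.2) ∨ (F.Adj a.1 b.1 ∧ a.2 = v ∧ b.2 = v) := Iff.rfl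

lemma glue_adj_root {i j : ι} (h : F.Adj i j) : (glue F G v).Adj (i, v) (j, v) :=
  Or.inr ⟨h, rfl, rfl⟩

lemma glue_sup_glue {F₁ F₂ : SimpleGraph ι} {R B : ι → SimpleGraph V} (hF : F₁ ⊔ F₂ = F)
    (hG : ∀ i, R i ⊔ B i = G i) : glue F₁ R v ⊔ glue F₂ B v = glue F G v := by
  ext a b
  simp only [sup_adj, glue_adj, ← hF, ← hG]
  tauto

lemma comap_glue (i : ι) : (glue F G v).comap (Prod.mk i) = G i := by
  ext x y
  simp [glue_adj]

lemma IsGoodCover.fiber {R B : SimpleGraph (ι × V)} {k ℓ : ℕ}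
    (h : IsGoodCover (glue F G v) R B k ℓ) (i : ι) :
    IsGoodCover (G i) (R.comap (Prod.mk i)) (B.comap (Prod.mk i)) k ℓ :=
  comap_glue (F := F) (G := G) (v := v) i ▸ h.comap (Prod.mk_right_injective i)

lemma IsPathEndpoint.of_glue {i : ι} {x : V} {n : ℕ} (hi : ∀ j, ¬ F.Adj i j)
    (h : IsPathEndpoint (glue F G v) (i, x) n) : IsPathEndpoint (G i) x n := by
  refine h.map_of_closed {a | a.1 = i} Prod.snd rfl ?_ ?_
  · rintro ⟨j, y⟩ rfl ⟨j', z⟩ (⟨hj, hadj⟩ | ⟨hj, -⟩)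
    · exact ⟨hj.symm, hadj⟩
    · exact absurd hj (hi _)
  · exact fun a ha b hb hab => Prod.ext (ha.trans hb.symm) hab

lemma HasNPath.of_glue {n : ℕ} (hiso : ∀ i, (∀ j, ¬ F.Adj i j) ∨ ∀ x, ¬ (G i).Adj v x)
    (h : HasNPath (glue F G v) n) : HasNPath F n ∨ ∃ i, HasNPath (G i) n := by
  obtain ⟨⟨i, x⟩, h⟩ := h
  change IsPathEndpoint _ _ _ at h
  by_cases hi : ∀ j, ¬ F.Adj i j
  · exact Or.inr ⟨i, (h.of_glue hi).hasNPath⟩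
  have hv := (hiso i).resolve_left hi
  by_cases hx : x = v
  · subst hx
    refine Or.inl (IsPathEndpoint.hasNPath (v := i) ?_)
    refine h.map_of_closed {a | a.2 = x ∧ ¬ ∀ j, ¬ F.Adj a.1 j} Prod.fst ⟨rfl, hi⟩ ?_ ?_
    · rintro ⟨j, y⟩ ⟨hy, hj⟩ ⟨j', z⟩ (⟨-, hadj⟩ | ⟨hjj, -, hz⟩)
      · obtain rfl : y = x := hy
        exact absurd hadj ((hiso j).resolve_left hj z)
      · exact ⟨⟨hz, fun h => h j hjj.symm⟩, hjj⟩
    · exact fun a ha b hb hab => Prod.ext hab (ha.1.trans hb.1.symm)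
  · refine Or.inr ⟨i, IsPathEndpoint.hasNPath (v := x) ?_⟩
    refine h.map_of_closed {a | a.1 = i ∧ a.2 ≠ v} Prod.snd ⟨rfl, hx⟩ ?_ ?_
    · rintro ⟨j, y⟩ ⟨rfl, hy⟩ ⟨j', z⟩ (⟨hj, hadj⟩ | ⟨-, hy', -⟩)
      · refine ⟨⟨hj.symm, ?_⟩, hadj⟩
        rintro rfl
        exact hv y hadj.symm
      · exact absurd hy' hy
    · exact fun a ha b hb hab => Prod.ext (ha.1.trans hb.1.symm) hab

end Glue

/-- Two paths in distinct fibers, starting at copies of `v`, are joined by a path through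
copies of `v` in further fibers. -/
lemma hasNPath_of_fibers {H : SimpleGraph (ι × V)} {v : V} {i j : ι} {m n : ℕ} (mid : List ι)
    (hnd : (i :: (mid ++ [j])).Nodup)
    (hc : ((i :: (mid ++ [j])).map fun c => (c, v)).IsChain H.Adj)
    (hi : IsPathEndpoint (H.comap (Prod.mk i)) v m)
    (hj : IsPathEndpoint (H.comap (Prod.mk j)) v n) : HasNPath H (m + mid.length + n) := by
  obtain ⟨s, rfl, hsc, hsn⟩ := isPathEndpoint_iff.1 hi
  obtain ⟨t, rfl, htc, htn⟩ := isPathEndpoint_iff.1 hj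
  set X := s.map (Prod.mk i) with hX
  set Y := t.map (Prod.mk j) with hY
  have hXc : ((i, v) :: X).IsChain H.Adj := by
    simpa [hX] using List.isChain_map_of_isChain (S := H.Adj) (Prod.mk i) (fun _ _ h => h) hsc
  have hYc : ((j, v) :: Y).IsChain H.Adj := by
    simpa [hY] using List.isChain_map_of_isChain (S := H.Adj) (Prod.mk j) (fun _ _ h => h) htc
  have hXr : (X.reverse ++ [(i, v)]).IsChain H.Adj := by
    rw [← List.reverse_cons, List.isChain_reverse]
    exact hXc.imp fun _ _ h => h.symm
  have hXn : ((i, v) :: X).Nodup := by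
    simpa [hX] using hsn.map (Prod.mk_right_injective i)
  have hYn : ((j, v) :: Y).Nodup := by
    simpa [hY] using htn.map (Prod.mk_right_injective j)
  have hpath : IsPathList H
      (X.reverse ++ (i, v) :: (mid.map (fun c => (c, v)) ++ (j, v) :: Y)) := by
    constructor
    · refine List.isChain_split.2 ⟨hXr, ?_⟩
      rw [← List.cons_append]
      exact List.isChain_split.2 ⟨by simpa using hc, hYc⟩
    · have hmid : (mid.map fun c => (c, v)).Nodup :=
        (List.nodup_append.1 (List.nodup_cons.1 hnd).2).1.map fun _ _ h => (Prod.ext_iff.1 h).1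
      have hX1 : ∀ a ∈ X, a.1 = i := by simp [hX]
      have hY1 : ∀ a ∈ Y, a.1 = j := by simp [hY]
      have hm1 : ∀ a ∈ mid.map (fun c => (c, v)), a.1 ∈ mid := by simp
      simp only [List.nodup_cons, List.mem_append, List.nodup_append, List.mem_singleton] at hnd
      have hij : i ≠ j := by grind
      have him : i ∉ mid := by grind
      have hjm : j ∉ mid := by grind
      rw [List.nodup_append', List.nodup_reverse, List.nodup_cons, List.nodup_append']
      refine ⟨(List.nodup_cons.1 hXn).2, ⟨?_, hmid, hYn, ?_⟩, ?_⟩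
      · intro h
        rcases List.mem_append.1 h with h | h
        · exact him (hm1 _ h)
        · rcases List.mem_cons.1 h with h | h
          · exact hij (Prod.ext_iff.1 h).1
          · exact hij (hY1 _ h)
      · intro a ha hb
        rcases List.mem_cons.1 hb with rfl | hb
        · exact hjm (hm1 _ ha)
        · exact hjm (hY1 a hb ▸ hm1 a ha)
      · intro a ha hb
        rw [List.mem_reverse] at ha
        rcases List.mem_cons.1 hb with rfl | hb
        · exact (List.nodup_cons.1 hXn).1 ha
        · rcases List.mem_append.1 hb with hb | hb
          · exact him (hX1 a ha ▸ hm1 a hb)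
          · rcases List.mem_cons.1 hb with rfl | hb
            · exact hij (hX1 _ ha).symm
            · exact hij ((hX1 a ha).symm.trans (hY1 a hb))
  have := hpath.hasNPath (by simp)
  convert this using 1
  simp [hX, hY]
  omega

/-- `G` with a new vertex `none` joined to `u` only. -/
def addLeaf (G : SimpleGraph V) (u : V) : SimpleGraph (Option V) :=
  G.map some ⊔ edge none (some u)

section AddLeaf

variable {G : SimpleGraph V} {u : V}

lemma map_some_adj {a b : Option V} :
    (G.map some).Adj a b ↔ ∃ a' b', G.Adj a' b' ∧ some a' = a ∧ some b' = b :=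
  SimpleGraph.map_adj Function.Embedding.some G a b

@[simp] lemma addLeaf_some_some {a b : V} : (addLeaf G u).Adj (some a) (some b) ↔ G.Adj a b := by
  simp [addLeaf, map_some_adj, edge_adj]

@[simp] lemma addLeaf_none_some {b : V} : (addLeaf G u).Adj none (some b) ↔ b = u := by
  simp [addLeaf, map_some_adj, edge_adj, eq_comm]

@[simp] lemma addLeaf_some_none {b : V} : (addLeaf G u).Adj (some b) none ↔ b = u := by
  rw [adj_comm, addLeaf_none_some]

lemma exists_map_some {l : List (Option V)} (hl : none ∉ l)
    (h : IsPathList (addLeaf G u) l) : ∃ l', l = l'.map some ∧ IsPathList G l' := by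
  obtain ⟨l', rfl⟩ : ∃ l' : List V, l = l'.map some := by
    induction l with
    | nil => exact ⟨[], rfl⟩
    | cons a l ih =>
      obtain ⟨l', rfl⟩ := ih (by grind) ⟨h.1.of_cons, h.2.of_cons⟩
      cases a with
      | none => simp at hl
      | some a => exact ⟨a :: l', rfl⟩
  refine ⟨l', rfl, ?_, h.2.of_map _⟩
  exact List.isChain_of_isChain_map some (fun a b => addLeaf_some_some.1) h.1

lemma IsPathEndpoint.of_addLeaf {n : ℕ} (hn : 1 ≤ n)
    (h : IsPathEndpoint (addLeaf G u) none (n + 1)) : IsPathEndpoint G u n := by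
  obtain ⟨t, ht, hc, hnd⟩ := isPathEndpoint_iff.1 h
  obtain ⟨t', rfl, ht'⟩ := exists_map_some (List.nodup_cons.1 hnd).1
    ⟨hc.of_cons, (List.nodup_cons.1 hnd).2⟩
  cases t' with
  | nil => simp at ht; omega
  | cons a t' =>
    obtain rfl : a = u := by simpa using hc.rel
    exact isPathEndpoint_iff.2 ⟨t', by simpa using ht, ht'⟩

lemma HasNPath.of_addLeaf {n : ℕ} (hn : 1 ≤ n) (h : HasNPath (addLeaf G u) (n + 1)) :
    HasNPath G (n + 1) ∨ IsPathEndpoint G u n := by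
  obtain ⟨a, ha⟩ := h
  obtain ⟨t, ht, hp⟩ := isPathEndpoint_iff.1 ha
  by_cases hmem : none ∈ a :: t
  · right
    apply IsPathEndpoint.of_addLeaf hn
    obtain ⟨s, r, hsr⟩ := List.append_of_mem hmem
    have hlen := congrArg List.length hsr
    simp only [List.length_cons, List.length_append] at hlen
    rw [hsr] at hp
    obtain ⟨hc, hnd⟩ := hp
    rcases List.eq_nil_or_concat s with rfl | ⟨s, b, rfl⟩
    · exact isPathEndpoint_iff.2 ⟨r, by simp at hlen; omega, hc, hnd⟩
    · cases r with
      | nil =>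
        refine isPathEndpoint_iff.2 ⟨(s.concat b).reverse, by simp at hlen ⊢; omega, ?_, ?_⟩
        · have : none :: (s.concat b).reverse = (s.concat b ++ [none]).reverse := by simp
          rw [this, List.isChain_reverse]
          exact hc.imp fun _ _ h => h.symm
        · have : none :: (s.concat b).reverse = (s.concat b ++ [none]).reverse := by simp
          rw [this, List.nodup_reverse]
          exact hnd
      | cons c r =>
        exfalso
        rw [List.concat_eq_append, List.append_assoc, List.singleton_append,
          List.isChain_append_cons_cons] at hc
        have h1 := hc.2.1
        have h2 := hc.2.2.rel
        rw [List.concat_eq_append] at hnd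
        cases b <;> cases c <;> simp at h1 h2
        subst h1 h2
        simp [List.nodup_append] at hnd
  · left
    obtain ⟨l', hl', hp'⟩ := exists_map_some hmem hp
    have hlen := congrArg List.length hl'
    have := hp'.hasNPath (by rintro rfl; simp at hl')
    simp only [List.length_cons, List.length_map] at hlen
    rwa [← hlen, ht] at this

lemma HasNPath.of_map_some {n : ℕ} (hn : 2 ≤ n) (h : HasNPath (G.map some) n) :
    HasNPath G n := by
  obtain ⟨a, h⟩ := h
  cases a with
  | none =>
    obtain ⟨t, rfl, hc, -⟩ := isPathEndpoint_iff.1 h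
    cases t with
    | nil => simp at hn
    | cons b t => simpa [map_some_adj] using hc.rel
  | some u =>
    refine IsPathEndpoint.hasNPath (v := u) ?_
    refine IsPathEndpoint.map_of_closed {a | a ≠ none} (fun a => a.getD u)
      (Option.some_ne_none u) ?_ ?_ h
    · rintro a - b hab
      obtain ⟨-, a', b', hab', rfl, rfl⟩ := hab
      exact ⟨Option.some_ne_none _, hab'⟩
    · rintro (_ | a) ha (_ | b) hb hab
      · rfl
      · exact absurd rfl ha
      · exact absurd rfl hb
      · exact congrArg some hab

end AddLeaf

end Gluing

section Transmitters

variable {V : Type*}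

lemma IsPathEndpoint.of_comap {W : Type*} {H : SimpleGraph W} {f : V → W} {v : V} {n : ℕ}
    (hf : Function.Injective f) (h : IsPathEndpoint (H.comap f) v n) :
    IsPathEndpoint H (f v) n :=
  h.map f hf fun _ _ => id

lemma isPathEndpoint_pathGraph (n : ℕ) [NeZero n] : IsPathEndpoint (pathGraph n) 0 n := by
  obtain ⟨m, rfl⟩ := Nat.exists_eq_succ_of_ne_zero (NeZero.ne n)
  refine isPathEndpoint_iff.2 ⟨(List.finRange m).map Fin.succ, by simp, ?_⟩
  rw [← List.finRange_succ]
  refine ⟨?_, List.nodup_finRange _⟩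
  rw [List.isChain_iff_getElem]
  intro i hi
  simp [pathGraph_adj]

/-- Some good cover has only blue edges at `v`, with no blue path on more than `β` vertices
ending in `v`, while every good cover has a blue path on `β` vertices ending in `v`. -/
structure IsBlueSource (G : SimpleGraph V) (v : V) (k ℓ β : ℕ) : Prop where
  exists_cover : ∃ R B, IsGoodCover G R B k ℓ ∧ (∀ u, ¬ R.Adj v u) ∧ ¬ IsPathEndpoint B v (β + 1)
  endpoint : ∀ {R B}, IsGoodCover G R B k ℓ → IsPathEndpoint B v β

/-- A blue source without red edges at `v` in any good cover. -/
structure IsBlueTransmitter (G : SimpleGraph V) (v : V) (k ℓ β : ℕ) : Prop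
    extends IsBlueSource G v k ℓ β where
  not_red : ∀ {R B}, IsGoodCover G R B k ℓ → ∀ u, ¬ R.Adj v u

/-- Every good cover has a red path on `k - 1` and a blue path on `β` vertices ending in `v`. -/
structure IsSaturated (G : SimpleGraph V) (v : V) (k ℓ β : ℕ) : Prop where
  exists_cover : ∃ R B, IsGoodCover G R B k ℓ ∧ ¬ IsPathEndpoint B v (β + 1)
  red_endpoint : ∀ {R B}, IsGoodCover G R B k ℓ → IsPathEndpoint R v (k - 1)
  blue_endpoint : ∀ {R B}, IsGoodCover G R B k ℓ → IsPathEndpoint B v β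

variable {G : SimpleGraph V} {v : V} {k ℓ β : ℕ}

lemma IsPathEndpoint.none_of_some {H : SimpleGraph (Option V)} {u : V} {n : ℕ}
    (hu : H.Adj none (some u)) (h : IsPathEndpoint (H.comap some) u n) :
    IsPathEndpoint H none (n + 1) := by
  obtain ⟨t, rfl, hc, hnd⟩ := isPathEndpoint_iff.1 h
  refine isPathEndpoint_iff.2 ⟨(u :: t).map some, by simp, ?_, ?_⟩
  · have := List.isChain_map_of_isChain (S := H.Adj) some (fun _ _ h => h) hc
    exact List.isChain_cons.2 ⟨by simpa using hu, this⟩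
  · exact List.nodup_cons.2 ⟨by simp, hnd.map (Option.some_injective _)⟩

lemma IsSaturated.addLeaf (h : IsSaturated G v k ℓ β) (hk : 2 ≤ k) (hβ : 1 ≤ β)
    (hβℓ : β + 2 ≤ ℓ) : IsBlueTransmitter (addLeaf G v) none k ℓ (β + 1) := by
  have hcomap : (_root_.addLeaf G v).comap some = G := by
    ext a b
    simp
  have hcover : ∀ {R B}, IsGoodCover (_root_.addLeaf G v) R B k ℓ →
      IsGoodCover G (R.comap some) (B.comap some) k ℓ := fun hRB =>
    hcomap ▸ hRB.comap (Option.some_injective V)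
  have hnot : ∀ {R B}, IsGoodCover (_root_.addLeaf G v) R B k ℓ →
      ¬ R.Adj none (some v) := fun hRB hv => by
    refine hRB.red ?_
    have := (IsPathEndpoint.none_of_some hv (h.red_endpoint (hcover hRB))).hasNPath
    rwa [Nat.sub_add_cancel (by omega)] at this
  refine ⟨⟨?_, ?_⟩, ?_⟩
  · obtain ⟨R, B, hRB, hB⟩ := h.exists_cover
    refine ⟨R.map some, _root_.addLeaf B v, ⟨?_, fun hp => hRB.red (hp.of_map_some hk), ?_⟩, ?_,
      fun hp => hB (hp.of_addLeaf (by omega))⟩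
    · ext a b
      rw [← hRB.sup_eq]
      cases a <;> cases b <;> simp [map_some_adj]
    · obtain ⟨n, rfl⟩ := Nat.exists_eq_add_of_le' (by omega : 1 ≤ ℓ)
      intro hp
      rcases hp.of_addLeaf (by omega) with hp | hp
      · exact hRB.blue hp
      · exact hB (hp.of_le (by omega) (by omega))
    · simp [map_some_adj]
  · intro R B hRB
    refine IsPathEndpoint.none_of_some ?_ (h.blue_endpoint (hcover hRB))
    exact (hRB.red_or_blue (by simp)).resolve_left (hnot hRB)
  · intro R B hRB u hu
    cases u with
    | none => exact R.loopless.irrefl _ hu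
    | some u =>
      obtain rfl : u = v := addLeaf_none_some.1 (hRB.red_le hu)
      exact hnot hRB hu

lemma IsBlueSource.isSaturated_glue (h : IsBlueSource G v k ℓ β) (n : ℕ) [NeZero n]
    (hk : k = n + 1) (hβ : ℓ ≤ 2 * β) (hℓ : 2 ≤ ℓ) :
    IsSaturated (glue (pathGraph n) (fun _ => G) v) (0, v) k ℓ β := by
  refine ⟨?_, ?_, fun hRB =>
    (h.endpoint (hRB.fiber 0)).of_comap (Prod.mk_right_injective _)⟩
  · obtain ⟨R, B, hRB, hR, hB⟩ := h.exists_cover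
    refine ⟨glue (pathGraph n) (fun _ => R) v, glue ⊥ (fun _ => B) v,
      ⟨glue_sup_glue (by simp) fun _ => hRB.sup_eq, ?_, ?_⟩,
      fun hp => hB (hp.of_glue (by simp))⟩
    · intro hp
      rcases hp.of_glue (fun _ => Or.inr hR) with hp | ⟨-, hp⟩
      · have := hp.le_card
        simp at this
        omega
      · exact hRB.red hp
    · intro hp
      rcases hp.of_glue (by simp) with hp | ⟨-, hp⟩
      · exact not_hasNPath_bot hℓ hp
      · exact hRB.blue hp
  · intro R B hRB
    rw [hk, Nat.add_sub_cancel]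
    refine (isPathEndpoint_pathGraph n).map (fun i => (i, v)) (Prod.mk_left_injective v) ?_
    intro i j hij
    refine (hRB.red_or_blue (glue_adj_root hij)).resolve_right fun hb => hRB.blue ?_
    refine (hasNPath_of_fibers [] (by simpa using hij.ne) (by simpa using hb)
      (h.endpoint (hRB.fiber i)) (h.endpoint (hRB.fiber j))).of_le (by omega) ?_
    simp
    omega

/-- If every good cover sends a blue path on `ℓ - 1` vertices to `v`, edges between copies of `v`
are red, so a path through copies of `v` is a transmitter of the other color. -/
lemma IsBlueTransmitter.glue_pathGraph (h : IsBlueTransmitter G v k ℓ (ℓ - 1)) {x : ℕ} [NeZero x]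
    (hx : 2 ≤ x) (hxk : x < k) (hℓ : 2 ≤ ℓ) :
    IsBlueTransmitter (glue (pathGraph x) (fun i => if i = 0 then ⊥ else G) v) (0, v) ℓ k x ∧
      ∀ {R B}, IsGoodCover (glue (pathGraph x) (fun i => if i = 0 then ⊥ else G) v) R B ℓ k →
        ¬ IsPathEndpoint B (0, v) (x + 1) := by
  have hfiber : ∀ {R B i},
      IsGoodCover (glue (pathGraph x) (fun i => if i = 0 then ⊥ else G) v) R B ℓ k → i ≠ 0 →
      IsGoodCover G (B.comap (Prod.mk i)) (R.comap (Prod.mk i)) k ℓ := by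
    intro R B i hRB hi
    simpa [hi] using hRB.swap.fiber i
  have hroot : ∀ {R B i j},
      IsGoodCover (glue (pathGraph x) (fun i => if i = 0 then ⊥ else G) v) R B ℓ k →
      (pathGraph x).Adj i j → ¬ R.Adj (i, v) (j, v) := by
    intro R B i j hRB hij hr
    wlog hj : j ≠ 0 generalizing i j
    · exact this hij.symm hr.symm fun hi => hij.ne (hi.trans (not_not.1 hj).symm)
    refine hRB.red ?_
    have := hasNPath_of_fibers [] (by simpa using hij.ne) (by simpa using hr)
      (isPathEndpoint_one v) (h.endpoint (hfiber hRB hj))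
    convert this using 1
    simp
    omega
  have hstrict : ∀ {R B},
      IsGoodCover (glue (pathGraph x) (fun i => if i = 0 then ⊥ else G) v) R B ℓ k →
        ¬ IsPathEndpoint B (0, v) (x + 1) := by
    intro R B hRB hp
    have : IsPathEndpoint (pathGraph x) 0 (x + 1) := by
      refine hp.map_of_closed {a | a.2 = v} Prod.fst rfl ?_ ?_
      · rintro ⟨i, a⟩ ha ⟨j, b⟩ hab
        obtain rfl : a = v := ha
        rcases hRB.blue_le hab with ⟨hij, hadj⟩ | ⟨hij, -, hb⟩
        · obtain rfl : i = j := hij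
          by_cases hi : i = 0
          · simp [hi] at hadj
          · exact absurd hab (h.not_red (hfiber hRB hi) b)
        · exact ⟨hb, hij⟩
      · exact fun a ha b hb hab => Prod.ext hab (ha.trans hb.symm)
    have := this.hasNPath.le_card
    simp at this
  refine ⟨⟨⟨?_, ?_⟩, ?_⟩, hstrict⟩
  · obtain ⟨R, B, hRB, hR, hB⟩ := h.exists_cover
    have hcover : IsGoodCover (glue (pathGraph x) (fun i => if i = 0 then ⊥ else G) v)
        (glue ⊥ (fun i => if i = 0 then ⊥ else B) v)
        (glue (pathGraph x) (fun i => if i = 0 then ⊥ else R) v) ℓ k := by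
      refine ⟨glue_sup_glue (by simp) fun i => ?_, fun hp => ?_, fun hp => ?_⟩
      · rw [← hRB.swap.sup_eq]
        split_ifs <;> simp
      · rcases hp.of_glue (by simp) with hp | ⟨i, hp⟩
        · exact not_hasNPath_bot hℓ hp
        · split_ifs at hp
          · exact not_hasNPath_bot hℓ hp
          · exact hRB.blue hp
      · rcases hp.of_glue (fun i => Or.inr fun u => by split_ifs; exacts [id, hR u])
          with hp | ⟨i, hp⟩
        · have := hp.le_card
          simp at this
          omega
        · split_ifs at hp
          · exact not_hasNPath_bot (by omega) hp
          · exact hRB.red hp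
    exact ⟨_, _, hcover, fun u => by simp [glue_adj], hstrict hcover⟩
  · intro R B hRB
    refine (isPathEndpoint_pathGraph x).map (fun i => (i, v)) (Prod.mk_left_injective v) ?_
    exact fun i j hij => (hRB.red_or_blue (glue_adj_root hij)).resolve_left (hroot hRB hij)
  · rintro R B hRB ⟨j, u⟩ hu
    rcases hRB.red_le hu with ⟨-, hadj⟩ | ⟨hij, -, rfl⟩
    · simp at hadj
    · exact hroot hRB hij hu

/-- There is a finite blue source with the given parameters. -/
def HasBlueSource (k ℓ β : ℕ) : Prop :=
  ∃ (V : Type) (_ : Finite V) (G : SimpleGraph V) (v : V), IsBlueSource G v k ℓ β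

/-- There is a finite blue transmitter with the given parameters. -/
def HasBlueTransmitter (k ℓ β : ℕ) : Prop :=
  ∃ (V : Type) (_ : Finite V) (G : SimpleGraph V) (v : V), IsBlueTransmitter G v k ℓ β

lemma HasBlueSource.hasBlueTransmitter (h : HasBlueSource k ℓ β) (hk : 2 ≤ k)
    (hβ : ℓ ≤ 2 * β) (hβℓ : β + 2 ≤ ℓ) : HasBlueTransmitter k ℓ (ℓ - 1) := by
  obtain ⟨n, rfl⟩ := Nat.exists_eq_add_of_le' (by omega : 1 ≤ k)
  obtain ⟨m, rfl⟩ := Nat.exists_eq_add_of_le' hβℓ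
  have : NeZero n := ⟨by omega⟩
  induction m generalizing β with
  | zero =>
    obtain ⟨V, hV, G, v, h⟩ := h
    have hleaf := (h.isSaturated_glue n rfl hβ (by omega)).addLeaf hk (by omega) hβℓ
    have heq : 0 + (β + 2) - 1 = β + 1 := by omega
    exact heq ▸ ⟨_, inferInstance, _, _, hleaf⟩
  | succ m ih =>
    obtain ⟨V, hV, G, v, h⟩ := h
    have hleaf := (h.isSaturated_glue n rfl hβ (by omega)).addLeaf hk (by omega) hβℓ
    have heq : m + 1 + (β + 2) = m + (β + 1 + 2) := by omega
    rw [heq] at hleaf hβ ⊢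
    exact ih (by omega) (by omega) ⟨_, inferInstance, _, _, hleaf.toIsBlueSource⟩

end Transmitters

section Constructions

variable {V ι : Type*}

lemma exists_uniform_finset {L M : Type*} [Fintype L] [Fintype M] (r : M → L → Prop) {n : ℕ}
    (hM : Fintype.card (Finset L) * n < Fintype.card M) :
    ∃ (S : Finset L) (T : Finset M), n < T.card ∧ ∀ m ∈ T, ∀ a, r m a ↔ a ∈ S := by
  classical
  obtain ⟨S, hS⟩ := Fintype.exists_lt_card_fiber_of_mul_lt_card
    (fun m => Finset.univ.filter (r m)) hM
  refine ⟨S, _, hS, fun m hm a => ?_⟩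
  rw [← (Finset.mem_filter.1 hm).2]
  simp

/-- Every good cover has a red path on `α` or a blue path on `β` vertices ending in `v`, and some
good cover has only red edges at `v` and no longer red path ending in `v`. -/
structure IsDichotomy (G : SimpleGraph V) (v : V) (k ℓ α β : ℕ) : Prop where
  exists_cover : ∃ R B, IsGoodCover G R B k ℓ ∧ (∀ u, ¬ B.Adj v u) ∧ ¬ IsPathEndpoint R v (α + 1)
  endpoint : ∀ {R B}, IsGoodCover G R B k ℓ → IsPathEndpoint R v α ∨ IsPathEndpoint B v β

lemma isDichotomy_bot (v : V) {k ℓ : ℕ} (β : ℕ) (hk : 2 ≤ k) (hℓ : 2 ≤ ℓ) :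
    IsDichotomy ⊥ v k ℓ 1 β :=
  ⟨⟨⊥, ⊥, ⟨by simp, not_hasNPath_bot hk, not_hasNPath_bot hℓ⟩, by simp,
    fun h => not_hasNPath_bot le_rfl h.hasNPath⟩, fun _ => Or.inl (isPathEndpoint_one v)⟩

lemma isDichotomy_completeBipartiteGraph {p q k ℓ N : ℕ} [NeZero p] (hk : 2 * p + 1 < k)
    (hk' : k ≤ 2 * p + 3) (hℓ : 2 * q + 1 < ℓ) (hℓ' : ℓ ≤ 2 * q + 3)
    (hN : Fintype.card (Finset (Fin p ⊕ Fin q)) * (p + q) < N) :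
    IsDichotomy (completeBipartiteGraph (Fin p ⊕ Fin q) (Fin N)) (Sum.inl (Sum.inl 0)) k ℓ
      (2 * p) (2 * q) := by
  classical
  constructor
  · let R : SimpleGraph ((Fin p ⊕ Fin q) ⊕ Fin N) :=
      fromRel fun x y => ∃ i m, x = Sum.inl (Sum.inl i) ∧ y = Sum.inr m
    let B : SimpleGraph ((Fin p ⊕ Fin q) ⊕ Fin N) :=
      fromRel fun x y => ∃ i m, x = Sum.inl (Sum.inr i) ∧ y = Sum.inr m
    have hR : ∀ a b, R.Adj a b → (∃ s ∈ (Finset.univ : Finset (Fin p)), Sum.inl (Sum.inl s) = a) ∨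
        ∃ s ∈ (Finset.univ : Finset (Fin p)), Sum.inl (Sum.inl s) = b := by
      rintro a b ⟨-, ⟨i, m, rfl, rfl⟩ | ⟨i, m, rfl, rfl⟩⟩ <;> simp
    have hB : ∀ a b, B.Adj a b → (∃ s ∈ (Finset.univ : Finset (Fin q)), Sum.inl (Sum.inr s) = a) ∨
        ∃ s ∈ (Finset.univ : Finset (Fin q)), Sum.inl (Sum.inr s) = b := by
      rintro a b ⟨-, ⟨i, m, rfl, rfl⟩ | ⟨i, m, rfl, rfl⟩⟩ <;> simp
    refine ⟨R, B, ⟨?_, not_hasNPath_of_cover _ _ hR (by simpa), not_hasNPath_of_cover _ _ hB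
      (by simpa)⟩, ?_, not_isPathEndpoint_of_cover _ _ hR (Finset.mem_univ 0) (by simp)⟩
    · ext a b
      rcases a with (a | a) | a <;> rcases b with (b | b) | b <;> simp [R, B]
    · rintro ((u | u) | u) <;> simp [B]
  · intro R B hRB
    obtain ⟨S, T, hT, hST⟩ := exists_uniform_finset
      (fun (m : Fin N) (a : Fin p ⊕ Fin q) => R.Adj (Sum.inl a) (Sum.inr m)) (by simpa using hN)
    have hred : ∀ y ∈ S.image Sum.inl, ∀ m ∈ T.image Sum.inr, R.Adj y m := by
      simp only [Finset.forall_mem_image]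
      exact fun a ha m hm => (hST m hm a).2 ha
    have hblue : ∀ y ∈ Sᶜ.image Sum.inl, ∀ m ∈ T.image Sum.inr, B.Adj y m := by
      simp only [Finset.forall_mem_image, Finset.mem_compl]
      exact fun a ha m hm =>
        (hRB.red_or_blue (by simp)).resolve_left fun h => ha ((hST m hm a).1 h)
    have hYS : (S.image (Sum.inl : _ → (Fin p ⊕ Fin q) ⊕ Fin N)).card = S.card :=
      Finset.card_image_of_injective _ Sum.inl_injective
    have hYS' : (Sᶜ.image (Sum.inl : _ → (Fin p ⊕ Fin q) ⊕ Fin N)).card = Sᶜ.card :=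
      Finset.card_image_of_injective _ Sum.inl_injective
    have hMT : (T.image (Sum.inr : _ → (Fin p ⊕ Fin q) ⊕ Fin N)).card = T.card :=
      Finset.card_image_of_injective _ Sum.inr_injective
    have hadd : S.card + Sᶜ.card = p + q := by simp
    have hSp : S.card ≤ p := by
      by_contra! hlt
      exact hRB.red ((hasNPath_of_biclique _ _ hred (by omega)).of_le (by omega) (by omega))
    have hSq : Sᶜ.card ≤ q := by
      by_contra! hlt
      exact hRB.blue ((hasNPath_of_biclique _ _ hblue (by omega)).of_le (by omega) (by omega))
    by_cases h0 : Sum.inl 0 ∈ S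
    · left
      have := isPathEndpoint_of_biclique _ _ hred (by omega) (Finset.mem_image_of_mem _ h0)
      rwa [hYS, show S.card = p by omega] at this
    · right
      have := isPathEndpoint_of_biclique _ _ hblue (by omega)
        (Finset.mem_image_of_mem _ (Finset.mem_compl.2 h0))
      rwa [hYS', show Sᶜ.card = q by omega] at this

lemma exists_isDichotomy {p q k ℓ : ℕ} (hp : 1 ≤ p) (hk : 2 * p + 1 < k) (hk' : k ≤ 2 * p + 3)
    (hℓ : 2 * q + 1 < ℓ) (hℓ' : ℓ ≤ 2 * q + 3) :
    ∃ (V : Type) (_ : Finite V) (G : SimpleGraph V) (v : V),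
      IsDichotomy G v k ℓ (2 * p) (2 * q) :=
  have : NeZero p := ⟨by omega⟩
  ⟨_, inferInstance, _, _, isDichotomy_completeBipartiteGraph hk hk' hℓ hℓ' (Nat.lt_succ_self _)⟩

lemma IsPathEndpoint.of_glue_root {F : SimpleGraph ι} {G : ι → SimpleGraph V} {v : V} {i : ι}
    {n : ℕ} (hv : ∀ i x, ¬ (G i).Adj v x) (h : IsPathEndpoint (glue F G v) (i, v) n) :
    IsPathEndpoint F i n := by
  refine h.map_of_closed {a | a.2 = v} Prod.fst rfl ?_ ?_
  · rintro ⟨i, a⟩ ha ⟨j, b⟩ (⟨-, hadj⟩ | ⟨hij, -, hb⟩)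
    · obtain rfl : a = v := ha
      exact absurd hadj (hv i b)
    · exact ⟨hb, hij⟩
  · exact fun a ha b hb hab => Prod.ext hab (ha.trans hb.symm)

lemma IsDichotomy.isBlueSource_glue {G : SimpleGraph V} {v : V} {k ℓ α β q N : ℕ} [NeZero q]
    (h : IsDichotomy G v k ℓ α β) (hk : k ≤ 2 * α + 1) (hℓ : ℓ ≤ 2 * β + 1) (hk2 : 2 ≤ k)
    (hq : k ≤ 2 * q + 1) (hq' : 2 * q + 1 < ℓ)
    (hN : Fintype.card (Finset (Option (Fin q))) * (q + 1) < N) :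
    IsBlueSource (glue (completeBipartiteGraph (Fin q) (Fin N))
      (Sum.elim (fun _ => ⊥) (fun _ => G)) v) (Sum.inl 0, v) k ℓ (2 * q) := by
  classical
  constructor
  · obtain ⟨R, B, hRB, hB, -⟩ := h.exists_cover
    have hcover : ∀ a b, (completeBipartiteGraph (Fin q) (Fin N)).Adj a b →
        (∃ s ∈ (Finset.univ : Finset (Fin q)), Sum.inl s = a) ∨
          ∃ s ∈ (Finset.univ : Finset (Fin q)), Sum.inl s = b := by
      rintro (a | a) (b | b) hab <;> simp at hab ⊢
    have hiso : ∀ i u, ¬ ((Sum.elim (fun _ => ⊥) (fun _ => B) : Fin q ⊕ Fin N → SimpleGraph V)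
        i).Adj v u := by
      rintro (i | i)
      · simp
      · exact hB
    refine ⟨glue ⊥ (Sum.elim (fun _ => ⊥) (fun _ => R)) v, glue (completeBipartiteGraph _ _)
      (Sum.elim (fun _ => ⊥) (fun _ => B)) v, ⟨glue_sup_glue (by simp) ?_, ?_, ?_⟩, ?_, ?_⟩
    · rintro (i | i)
      · simp
      · exact hRB.sup_eq
    · intro hp
      rcases hp.of_glue (by simp) with hp | ⟨i | i, hp⟩
      · exact not_hasNPath_bot hk2 hp
      · exact not_hasNPath_bot hk2 hp
      · exact hRB.red hp
    · intro hp
      rcases hp.of_glue (fun i => Or.inr (hiso i)) with hp | ⟨i | i, hp⟩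
      · exact not_hasNPath_of_cover _ _ hcover (by simpa) hp
      · exact not_hasNPath_bot (by omega) hp
      · exact hRB.blue hp
    · simp [glue_adj]
    · exact fun hp => not_isPathEndpoint_of_cover _ _ hcover (Finset.mem_univ 0) (by simp)
        (hp.of_glue_root hiso)
  · intro R B hRB
    obtain ⟨S, T, hT, hST⟩ := exists_uniform_finset (fun (m : Fin N) (o : Option (Fin q)) =>
      o.elim (IsPathEndpoint (R.comap (Prod.mk (Sum.inr m))) v α)
        fun i => R.Adj (Sum.inl i, v) (Sum.inr m, v)) (by simpa using hN)
    obtain ⟨m₁, hm₁, m₂, hm₂, hne⟩ := Finset.one_lt_card.1 (by omega : 1 < T.card)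
    have hYc : ((Finset.univ : Finset (Fin q)).image
        fun i => ((Sum.inl i, v) : (Fin q ⊕ Fin N) × V)).card = q := by
      rw [Finset.card_image_of_injective _ fun _ _ h => Sum.inl_injective (Prod.ext_iff.1 h).1]
      simp
    have hMc : (T.image fun m => ((Sum.inr m, v) : (Fin q ⊕ Fin N) × V)).card = T.card :=
      Finset.card_image_of_injective _ fun _ _ h => Sum.inr_injective (Prod.ext_iff.1 h).1
    have hedge : ∀ i m, R.Adj (Sum.inl i, v) (Sum.inr m, v) ∨ B.Adj (Sum.inl i, v) (Sum.inr m, v) :=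
      fun i m => hRB.red_or_blue (glue_adj_root (by simp))
    by_cases htype : none ∈ S
    · have hS : ∀ i, some i ∉ S := by
        intro i hi
        have h₁ := (hST m₁ hm₁ (some i)).2 hi
        have h₂ := (hST m₂ hm₂ (some i)).2 hi
        refine hRB.red ((hasNPath_of_fibers [Sum.inl i] (by simpa using hne) ?_
          ((hST m₁ hm₁ none).2 htype) ((hST m₂ hm₂ none).2 htype)).of_le (by omega) ?_)
        · simpa using ⟨h₁.symm, h₂⟩
        · simp
          omega
      have := isPathEndpoint_of_biclique (G := B) _ (T.image fun m => (Sum.inr m, v)) ?_ (by omega)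
        (Finset.mem_image_of_mem (fun i => ((Sum.inl i, v) : (Fin q ⊕ Fin N) × V))
          (Finset.mem_univ 0))
      · rwa [hYc] at this
      · simp only [Finset.forall_mem_image]
        exact fun i _ m hm => (hedge i m).resolve_left fun h => hS i ((hST m hm (some i)).1 h)
    · have hblue : ∀ m ∈ T, IsPathEndpoint (B.comap (Prod.mk (Sum.inr m))) v β := fun m hm =>
        (h.endpoint (hRB.fiber (Sum.inr m))).resolve_left fun h => htype ((hST m hm none).1 h)
      have hS : ∀ i, some i ∈ S := by
        intro i
        by_contra hi
        have h₁ := (hedge i m₁).resolve_left fun h => hi ((hST m₁ hm₁ (some i)).1 h)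
        have h₂ := (hedge i m₂).resolve_left fun h => hi ((hST m₂ hm₂ (some i)).1 h)
        refine hRB.blue ((hasNPath_of_fibers [Sum.inl i] (by simpa using hne) ?_
          (hblue m₁ hm₁) (hblue m₂ hm₂)).of_le (by omega) ?_)
        · simpa using ⟨h₁.symm, h₂⟩
        · simp
          omega
      refine absurd ((hasNPath_of_biclique (G := R)
        ((Finset.univ : Finset (Fin q)).image fun i => (Sum.inl i, v))
        (T.image fun m => (Sum.inr m, v)) ?_ (by omega)).of_le (by omega) (by omega)) hRB.red
      simp only [Finset.forall_mem_image]
      exact fun i _ m hm => (hST m hm (some i)).2 (hS i)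

lemma hasBlueSource_of_lt {p q k ℓ : ℕ} (hpq : p < q) (hk : 2 * p + 1 < k) (hk2 : 2 ≤ k)
    (hk' : k ≤ 2 * p + 3) (hℓ : 2 * q + 1 < ℓ) (hℓ' : ℓ ≤ 2 * q + 3) :
    HasBlueSource k ℓ (2 * q) := by
  have : NeZero q := ⟨by omega⟩
  rcases Nat.eq_zero_or_pos p with rfl | hp
  · exact ⟨_, inferInstance, _, _, (isDichotomy_bot () ℓ hk2 (by omega)).isBlueSource_glue
      (by omega) (by omega) hk2 (by omega) hℓ (Nat.lt_succ_self _)⟩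
  · obtain ⟨V, hV, G, v, h⟩ := exists_isDichotomy hp hk hk' hℓ hℓ'
    exact ⟨_, inferInstance, _, _, h.isBlueSource_glue (by omega) (by omega) hk2 (by omega) hℓ
      (Nat.lt_succ_self _)⟩

end Constructions

section SmallDifference

variable {V : Type*}

lemma IsDichotomy.isSaturated_glue_top {G : SimpleGraph V} {v : V} {k ℓ α : ℕ} [NeZero k]
    (h : IsDichotomy G v k ℓ α α) (hk : k = α + 2) (hℓ : ℓ = α + 3) (hα : 3 ≤ α) :
    IsSaturated (glue (⊤ : SimpleGraph (Fin k)) (fun _ => G) v) (0, v) ℓ k α := by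
  classical
  have key : ∀ {R B}, IsGoodCover (glue (⊤ : SimpleGraph (Fin k)) (fun _ => G) v) R B k ℓ →
      (∀ i, IsPathEndpoint (R.comap (Prod.mk i)) v α) ∧
        ∀ i j, i ≠ j → B.Adj (i, v) (j, v) := by
    intro R B hRB
    have hedge : ∀ i j, i ≠ j → R.Adj (i, v) (j, v) ∨ B.Adj (i, v) (j, v) := fun i j hij =>
      hRB.red_or_blue (glue_adj_root hij)
    set r := fun i => IsPathEndpoint (R.comap (Prod.mk i)) v α with hr
    have hblue : ∀ i, ¬ r i → IsPathEndpoint (B.comap (Prod.mk i)) v α := fun i hi =>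
      (h.endpoint (hRB.fiber i)).resolve_left hi
    have hrr : ∀ i j, r i → r j → i ≠ j → B.Adj (i, v) (j, v) := by
      intro i j hi hj hij
      refine (hedge i j hij).resolve_left fun hR => hRB.red ?_
      refine (hasNPath_of_fibers [] (by simpa) (by simpa) hi hj).of_le (by omega) ?_
      simp
      omega
    have hbb : ∀ i j, ¬ r i → ¬ r j → i ≠ j → R.Adj (i, v) (j, v) := by
      intro i j hi hj hij
      refine (hedge i j hij).resolve_right fun hB => hRB.blue ?_
      refine (hasNPath_of_fibers [] (by simpa) (by simpa) (hblue i hi) (hblue j hj)).of_le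
        (by omega) ?_
      simp
      omega
    suffices hall : ∀ i, r i from ⟨hall, fun i j => hrr i j (hall i) (hall j)⟩
    by_contra! hs
    obtain ⟨s, hs⟩ := hs
    by_cases hR : ∃ i, r i
    · obtain ⟨i, hi⟩ := hR
      have hne : ∀ {i j}, r i → ¬ r j → i ≠ j := fun hi hj hij => hj (hij ▸ hi)
      by_cases hs' : ∃ t, ¬ r t ∧ t ≠ s
      · obtain ⟨t, ht, hts⟩ := hs'
        have hB : ∀ {t t'}, ¬ r t → ¬ r t' → t ≠ t' → B.Adj (t, v) (i, v) := by
          intro t t' ht ht' htt'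
          refine (hedge t i (hne hi ht).symm).resolve_left fun hR => hRB.red ?_
          refine (hasNPath_of_fibers (i := t') [t] ?_ ?_ (isPathEndpoint_one v) hi).of_le
            (by omega) ?_
          · simpa using ⟨⟨htt'.symm, (hne hi ht').symm⟩, (hne hi ht).symm⟩
          · simpa using ⟨hbb t' t ht' ht htt'.symm, hR⟩
          · simp
            omega
        refine hRB.blue ((hasNPath_of_fibers [i] ?_ ?_ (hblue s hs) (hblue t ht)).of_le
          (by omega) ?_)
        · simpa using ⟨⟨(hne hi hs).symm, hts.symm⟩, hne hi ht⟩
        · simpa using ⟨hB hs ht hts.symm, (hB ht hs hts).symm⟩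
        · simp
          omega
      · push Not at hs'
        have hr' : ∀ i, i ≠ s → r i := fun i his => by
          by_contra hi
          exact his (hs' i hi)
        obtain ⟨a, b, c, ha, hb, hc, hab, hac, hbc⟩ : ∃ a b c : Fin k,
            a ≠ s ∧ b ≠ s ∧ c ≠ s ∧ a ≠ b ∧ a ≠ c ∧ b ≠ c := by
          obtain ⟨T, hT, hcard⟩ := Finset.exists_subset_card_eq
            (show 3 ≤ (Finset.univ.erase s).card by
              simp [Finset.card_erase_of_mem]; omega)
          obtain ⟨a, b, c, hab, hac, hbc, rfl⟩ := Finset.card_eq_three.1 hcard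
          have : ∀ x ∈ ({a, b, c} : Finset (Fin k)), x ≠ s := fun x hx =>
            Finset.ne_of_mem_erase (hT hx)
          exact ⟨a, b, c, this a (by simp), this b (by simp), this c (by simp), hab, hac, hbc⟩
        have hR : ∀ {a b c}, a ≠ s → b ≠ s → c ≠ s → a ≠ b → a ≠ c → b ≠ c →
            R.Adj (a, v) (s, v) := by
          intro a b c ha hb hc hab hac hbc
          refine (hedge a s ha).resolve_right fun hB => hRB.blue ?_
          have := hasNPath_of_fibers [b, a] (i := c) (j := s) (H := B) ?_ ?_
            (isPathEndpoint_one v) (hblue s hs)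
          · convert this using 1
            simp
            omega
          · simp
            tauto
          · simpa using ⟨hrr c b (hr' c hc) (hr' b hb) hbc.symm,
              hrr b a (hr' b hb) (hr' a ha) hab.symm, hB⟩
        refine hRB.red ((hasNPath_of_fibers [s] ?_ ?_ (hr' a ha) (hr' b hb)).of_le
          (by omega) ?_)
        · simp
          tauto
        · simpa using ⟨hR ha hb hc hab hac hbc, (hR hb ha hc hab.symm hbc hac).symm⟩
        · simp
          omega
    · push Not at hR
      refine hRB.red ⟨(0, v), (isPathEndpoint_pathGraph k).map (fun i => (i, v))
        (Prod.mk_left_injective v) ?_⟩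
      exact fun i j hij => hbb i j (hR i) (hR j) hij.ne
  refine ⟨?_, ?_, fun hRB => ((key hRB.swap).1 0).of_comap (Prod.mk_right_injective _)⟩
  · obtain ⟨R, B, hRB, hB, hR⟩ := h.exists_cover
    refine ⟨glue ⊤ (fun _ => B) v, glue ⊥ (fun _ => R) v,
      ⟨glue_sup_glue (by simp) fun _ => hRB.swap.sup_eq, ?_, ?_⟩,
      fun hp => hR (hp.of_glue (by simp))⟩
    · intro hp
      rcases hp.of_glue (fun _ => Or.inr hB) with hp | ⟨-, hp⟩
      · have := hp.le_card
        simp at this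
        omega
      · exact hRB.blue hp
    · intro hp
      rcases hp.of_glue (by simp) with hp | ⟨-, hp⟩
      · exact not_hasNPath_bot (by omega) hp
      · exact hRB.red hp
  · intro R B hRB
    rw [show ℓ - 1 = k by omega]
    refine (isPathEndpoint_pathGraph k).map (fun i => (i, v)) (Prod.mk_left_injective v) ?_
    exact fun i j hij => (key hRB.swap).2 i j hij.ne

lemma hasBlueTransmitter_of_even {p : ℕ} (hp : 2 ≤ p) :
    HasBlueTransmitter (2 * p + 3) (2 * p + 2) (2 * p + 1) := by
  obtain ⟨V, hV, G, v, h⟩ := exists_isDichotomy (p := p) (q := p) (k := 2 * p + 2)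
    (ℓ := 2 * p + 3) (by omega) (by omega) (by omega) (by omega) (by omega)
  exact ⟨_, inferInstance, _, _, (h.isSaturated_glue_top rfl rfl (by omega)).addLeaf
    (by omega) (by omega) le_rfl⟩

lemma hasBlueSource_five_four : HasBlueSource 5 4 2 := by
  let R₀ : SimpleGraph (Option (Option (Fin 4))) := ((⊤ : SimpleGraph (Fin 4)).map some).map some
  let B₀ : SimpleGraph (Option (Option (Fin 4))) := fromRel fun x _ => x = some none
  have hcover : ∀ a b, B₀.Adj a b → (∃ s ∈ ({()} : Finset Unit), (some none : _) = a) ∨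
      ∃ s ∈ ({()} : Finset Unit), (some none : _) = b := by
    rintro a b ⟨-, rfl | rfl⟩ <;> simp
  have hroot : ∀ a, a ≠ some none → (R₀ ⊔ B₀).Adj (some none) a := fun a ha =>
    Or.inr ⟨ha.symm, Or.inl rfl⟩
  have hclique : ∀ a b : Fin 4, a ≠ b → (R₀ ⊔ B₀).Adj (some (some a)) (some (some b)) :=
    fun a b hab => Or.inl (by simp [R₀, map_some_adj, -map_map, hab])
  refine ⟨_, inferInstance, R₀ ⊔ B₀, some none, ⟨R₀, B₀, ⟨rfl, ?_, ?_⟩, ?_, ?_⟩, ?_⟩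
  · intro h
    have := ((h.of_map_some (by norm_num)).of_map_some (by norm_num)).le_card
    simp at this
  · exact not_hasNPath_of_cover _ _ hcover (by simp)
  · simp [R₀, map_some_adj, -map_map]
  · exact not_isPathEndpoint_of_cover _ (fun _ => some none) hcover (Finset.mem_univ ()) (by simp)
  · intro R B hRB
    by_contra hB
    have hR : ∀ a, a ≠ some none → R.Adj (some none) a := by
      intro a ha
      refine (hRB.red_or_blue (hroot a ha)).resolve_right fun h => hB ?_
      exact isPathEndpoint_iff.2 ⟨[a], rfl, by simpa using h, by simpa using ha.symm⟩
    have hblue : ∀ a b c d : Fin 4, [a, b, c, d].Nodup →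
        B.Adj (some (some a)) (some (some b)) := by
      intro a b c d hnd
      simp only [List.nodup_cons, List.mem_cons, List.not_mem_nil, or_false, not_or] at hnd
      have hstep : ∀ x y z : Fin 4, x ≠ y → x ≠ z → y ≠ z →
          R.Adj (some (some x)) (some (some y)) → ¬ R.Adj (some (some y)) (some (some z)) := by
        intro x y z hxy hxz hyz h₁ h₂
        refine hRB.red (IsPathList.hasNPath
          (l := [none, some none, some (some x), some (some y), some (some z)]) ⟨?_, ?_⟩ (by simp))
        · simpa using ⟨(hR none (by simp)).symm, hR _ (by simp), h₁, h₂⟩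
        · simp [hxy, hxz, hyz]
      by_contra hab
      have hab := (hRB.red_or_blue (hclique a b (by tauto))).resolve_right hab
      have hB' : ∀ x y, x ≠ y → ¬ R.Adj (some (some x)) (some (some y)) →
          B.Adj (some (some x)) (some (some y)) := fun x y hxy =>
        (hRB.red_or_blue (hclique x y hxy)).resolve_left
      refine hRB.blue (IsPathList.hasNPath
        (l := [some (some a), some (some c), some (some b), some (some d)]) ⟨?_, ?_⟩ (by simp))
      · simp only [List.isChain_cons_cons, List.isChain_singleton, and_true]
        refine ⟨hB' _ _ (by tauto) (hstep b a c ?_ ?_ ?_ hab.symm),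
          (hB' _ _ (by tauto) (hstep a b c ?_ ?_ ?_ hab)).symm,
          hB' _ _ (by tauto) (hstep a b d ?_ ?_ ?_ hab)⟩ <;> tauto
      · simp
        tauto
    refine hRB.blue (IsPathList.hasNPath
      (l := [some (some 0), some (some 1), some (some 2), some (some 3)]) ⟨?_, by decide⟩ (by simp))
    simpa using ⟨hblue 0 1 2 3 (by decide), hblue 1 2 0 3 (by decide), hblue 2 3 0 1 (by decide)⟩

lemma hasBlueTransmitter_three_five : HasBlueTransmitter 3 5 4 := by
  let R₀ : SimpleGraph (Fin 7) := fromRel fun x y => x = 0 ∧ y = 1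
  let B₀ : SimpleGraph (Fin 7) := fromRel fun x y =>
    (x = 1 ∧ (y = 3 ∨ y = 4)) ∨ (x = 2 ∧ (y = 0 ∨ y = 5 ∨ y = 6))
  have hB₀ : ¬ HasNPath B₀ 4 := by
    rintro ⟨a, h⟩
    obtain ⟨t, ht, hc, hnd⟩ := isPathEndpoint_iff.1 h
    match t, ht with
    | [b, c, d], _ =>
      simp only [List.isChain_cons_cons, List.nodup_cons, List.mem_cons, List.not_mem_nil, or_false,
        not_or, B₀, fromRel_adj] at hc hnd
      grind
  have hsat : IsSaturated (R₀ ⊔ B₀) 0 3 5 3 := by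
    have hmid : ∀ {R B}, IsGoodCover (R₀ ⊔ B₀) R B 3 5 → ∀ c x y, x ≠ y → c ≠ x → c ≠ y →
        (R₀ ⊔ B₀).Adj c x → (R₀ ⊔ B₀).Adj c y → B.Adj c x ∨ B.Adj c y := by
      intro R B hRB c x y hxy hcx hcy hx hy
      by_contra! h
      refine hRB.red (IsPathList.hasNPath (l := [x, c, y]) ⟨?_, ?_⟩ (by simp))
      · simpa using ⟨((hRB.red_or_blue hx).resolve_right h.1).symm,
          (hRB.red_or_blue hy).resolve_right h.2⟩
      · simp [hxy, hcx.symm, hcy]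
    have hend : ∀ {R B}, IsGoodCover (R₀ ⊔ B₀) R B 3 5 →
        IsPathEndpoint R 0 2 ∧ IsPathEndpoint B 0 3 := by
      intro R B hRB
      obtain ⟨x, hx, hBx⟩ : ∃ x : Fin 7, (x = 3 ∨ x = 4) ∧ B.Adj 1 x := by
        rcases hmid hRB 1 3 4 (by decide) (by decide) (by decide) (by simp [R₀, B₀])
          (by simp [R₀, B₀]) with h | h
        exacts [⟨3, by simp, h⟩, ⟨4, by simp, h⟩]
      obtain ⟨y, hy, hBy⟩ : ∃ y : Fin 7, (y = 5 ∨ y = 6) ∧ B.Adj 2 y := by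
        rcases hmid hRB 2 5 6 (by decide) (by decide) (by decide) (by simp [R₀, B₀])
          (by simp [R₀, B₀]) with h | h
        exacts [⟨5, by simp, h⟩, ⟨6, by simp, h⟩]
      have hnot : ¬ (B.Adj 0 1 ∧ B.Adj 0 2) := by
        rintro ⟨h₁, h₂⟩
        refine hRB.blue (IsPathList.hasNPath (l := [x, 1, 0, 2, y]) ⟨?_, ?_⟩ (by simp))
        · simpa using ⟨hBx.symm, h₁.symm, h₂, hBy⟩
        · rcases hx with rfl | rfl <;> rcases hy with rfl | rfl <;> decide
      have h01 : (R₀ ⊔ B₀).Adj 0 1 := by simp [R₀]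
      have h02 : (R₀ ⊔ B₀).Adj 0 2 := by simp [B₀]
      constructor
      · obtain ⟨z, hz, hRz⟩ : ∃ z : Fin 7, z ≠ 0 ∧ R.Adj 0 z := by
          by_contra! h
          exact hnot ⟨(hRB.red_or_blue h01).resolve_left (h 1 (by decide)),
            (hRB.red_or_blue h02).resolve_left (h 2 (by decide))⟩
        exact isPathEndpoint_iff.2 ⟨[z], rfl, by simpa using hRz, by simpa using hz.symm⟩
      · rcases hmid hRB 0 1 2 (by decide) (by decide) (by decide) h01 h02 with h | h
        · refine isPathEndpoint_iff.2 ⟨[1, x], rfl, by simpa using ⟨h, hBx⟩, ?_⟩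
          rcases hx with rfl | rfl <;> decide
        · refine isPathEndpoint_iff.2 ⟨[2, y], rfl, by simpa using ⟨h, hBy⟩, ?_⟩
          rcases hy with rfl | rfl <;> decide
    refine ⟨⟨R₀, B₀, ⟨rfl, ?_, fun h => hB₀ (h.of_le (by norm_num) (by norm_num))⟩,
      fun h => hB₀ h.hasNPath⟩, fun hRB => (hend hRB).1, fun hRB => (hend hRB).2⟩
    rintro ⟨a, h⟩
    obtain ⟨t, ht, hc, hnd⟩ := isPathEndpoint_iff.1 h
    match t, ht with
    | [b, c], _ =>
      simp only [List.isChain_cons_cons, List.nodup_cons, List.mem_cons, List.not_mem_nil, or_false,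
        not_or, R₀, fromRel_adj] at hc hnd
      grind
  exact ⟨_, inferInstance, _, _, hsat.addLeaf (by norm_num) (by norm_num) (by norm_num)⟩

end SmallDifference

/-- Transmitters of maximal strength exist in at least one of the colors. -/
lemma hasBlueTransmitter_or {k ℓ : ℕ} (hk : 3 ≤ k) (hkl : k < ℓ) (h3 : k = 3 → 5 ≤ ℓ) :
    HasBlueTransmitter k ℓ (ℓ - 1) ∨ HasBlueTransmitter ℓ k (k - 1) := by
  by_cases hlt : k / 2 < ℓ / 2
  · left
    by_cases h5 : ℓ = 5
    · obtain rfl : k = 3 := by omega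
      subst h5
      exact hasBlueTransmitter_three_five
    · exact (hasBlueSource_of_lt (p := k / 2 - 1) (q := ℓ / 2 - 1) (by omega) (by omega) (by omega)
        (by omega) (by omega) (by omega)).hasBlueTransmitter (by omega) (by omega) (by omega)
  · right
    obtain ⟨p, rfl⟩ : ∃ p, k = 2 * p + 2 := ⟨k / 2 - 1, by omega⟩
    obtain rfl : ℓ = 2 * p + 3 := by omega
    obtain rfl | hp : p = 1 ∨ 2 ≤ p := by omega
    · exact hasBlueSource_five_four.hasBlueTransmitter (by norm_num) (by norm_num) (by norm_num)
    · exact hasBlueTransmitter_of_even hp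

lemma hasBlueTransmitter {k ℓ : ℕ} (hk : 3 ≤ k) (hkl : k < ℓ) (h3 : k = 3 → 5 ≤ ℓ) :
    HasBlueTransmitter k ℓ (ℓ - 1) := by
  refine (hasBlueTransmitter_or hk hkl h3).elim id ?_
  rintro ⟨V, hV, G, v, h⟩
  have : NeZero (ℓ - 1) := ⟨by omega⟩
  exact ⟨_, inferInstance, _, _, (h.glue_pathGraph (by omega) (by omega) (by omega)).1⟩

lemma GoodColoring.isGoodCover {V : Type*} {G R : SimpleGraph V} {k ℓ : ℕ}
    (h : GoodColoring G R k ℓ) : IsGoodCover G R (G \ R) k ℓ :=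
  ⟨sup_sdiff_cancel_right h.1, h.2.1, h.2.2⟩

lemma IsGoodCover.goodColoring {V : Type*} {G R B : SimpleGraph V} {k ℓ : ℕ}
    (h : IsGoodCover G R B k ℓ) : GoodColoring G R k ℓ :=
  ⟨h.red_le, h.red, fun hp => h.blue (hp.mono (sdiff_le_iff.2 h.sup_eq.ge))⟩

/-- for 3 ≤ k < ℓ (with ℓ ≥ 5 when k = 3) and 2 ≤ x ≤ k−1 there exists a
(k, ℓ, x)-red-transmitter. -/
theorem stmt6 (k ℓ x : ℕ) (hk : 3 ≤ k) (hkl : k < ℓ) (h3 : k = 3 → 5 ≤ ℓ)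
    (hx2 : 2 ≤ x) (hxk : x ≤ k - 1) :
    ∃ (n : ℕ) (G : SimpleGraph (Fin n)) (v : Fin n),
      IsGood G k ℓ ∧
      ∀ R : SimpleGraph (Fin n), GoodColoring G R k ℓ →
        StrictEndpoint R v x ∧ ∀ u, ¬ (G \ R).Adj v u := by
  obtain ⟨V, hV, G, v, h⟩ := hasBlueTransmitter hk hkl h3
  have : NeZero x := ⟨by omega⟩
  obtain ⟨ht, hstrict⟩ := h.glue_pathGraph hx2 (by omega) (by omega)
  set H := glue (pathGraph x) (fun i => if i = 0 then ⊥ else G) v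
  obtain ⟨n, ⟨e⟩⟩ := Finite.exists_equiv_fin (Fin x × V)
  refine ⟨n, H.comap e.symm, e (0, v), ?_, fun R hR => ?_⟩
  · obtain ⟨B, R, hBR, -⟩ := ht.exists_cover
    exact ⟨_, (hBR.swap.comap e.symm.injective).goodColoring⟩
  · have hcover := (hR.isGoodCover.comap e.injective).swap
    have hH : (H.comap e.symm).comap e = H := by
      ext a b
      simp
    rw [hH] at hcover
    refine ⟨⟨(ht.endpoint hcover).of_comap e.injective, fun y hy => ?_⟩, fun u hu => ?_⟩
    · by_contra! hlt
      refine hstrict hcover ?_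
      have := (hy.of_le (by omega) hlt).map (H := R.comap e) e.symm e.symm.injective (by simp)
      simpa using this
    · refine ht.not_red hcover (e.symm u) ?_
      simpa using hu
end

section
/- Let k ≥ 1 and let G be a graph whose vertex set is partitioned into sets M and N such that |M| = k, |N| ≥ k, every vertex of M is adjacent to every vertex of N, and N is an independent set (edges inside M are arbitrary). Then every vertex of M is an endpoint of a path on 2k vertices in G, and no path of G on more than 2k vertices has an endpoint in M. -/
/-- In a complete bipartite pattern between disjoint `M` and `N`, with `M.card = k + 1 ≤ N.card`,
every vertex of `M` starts an alternating path on `2 * (k + 1)` vertices. -/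
theorem exists_isPath_of_complete_between {V : Type*} [DecidableEq V] (G : SimpleGraph V) (k : ℕ)
    (M N : Finset V) (hdisj : Disjoint M N) (hM : M.card = k + 1) (hN : k + 1 ≤ N.card)
    (hadj : ∀ m ∈ M, ∀ n ∈ N, G.Adj m n) (m : V) (hm : m ∈ M) :
    ∃ (w : V) (p : G.Walk m w), p.IsPath ∧ p.length + 1 = 2 * (k + 1) ∧
      ∀ x ∈ p.support, x ∈ M ∪ N := by
  induction k generalizing M N m with
  | zero =>
    obtain ⟨n, hn⟩ : N.Nonempty := Finset.card_pos.mp (by omega)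
    have hmn := hadj m hm n hn
    refine ⟨n, .cons hmn .nil, ?_, by simp, ?_⟩
    · simp [SimpleGraph.Walk.cons_isPath_iff, hmn.ne]
    · simp [hm, hn]
  | succ k ih =>
    obtain ⟨n, hn⟩ : N.Nonempty := Finset.card_pos.mp (by omega)
    have hMe : (M.erase m).card = k + 1 := by rw [Finset.card_erase_of_mem hm]; omega
    have hNe : k + 1 ≤ (N.erase n).card := by rw [Finset.card_erase_of_mem hn]; omega
    obtain ⟨m', hm'⟩ : (M.erase m).Nonempty := Finset.card_pos.mp (by omega)
    obtain ⟨w, p, hp, hlen, hsupp⟩ := ih (M.erase m) (N.erase n)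
      (hdisj.mono (Finset.erase_subset _ _) (Finset.erase_subset _ _)) hMe hNe
      (fun a ha b hb => hadj a (Finset.mem_of_mem_erase ha) b (Finset.mem_of_mem_erase hb)) m' hm'
    have hmn := hadj m hm n hn
    have hnm' := (hadj m' (Finset.mem_of_mem_erase hm') n hn).symm
    have hmN : m ∉ N := Finset.disjoint_left.mp hdisj hm
    have hnM : n ∉ M := Finset.disjoint_right.mp hdisj hn
    have hnp : n ∉ p.support := fun h => by simpa [hnM] using hsupp n h
    have hmp : m ∉ p.support := fun h => by simpa [hmN] using hsupp m h
    refine ⟨w, .cons hmn (.cons hnm' p), ?_, ?_, ?_⟩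
    · simp [SimpleGraph.Walk.cons_isPath_iff, hp, hnp, hmp, hmn.ne]
    · simp only [SimpleGraph.Walk.length_cons]
      omega
    · intro x hx
      simp only [SimpleGraph.Walk.support_cons, List.mem_cons] at hx
      rcases hx with rfl | rfl | hx
      · exact Finset.mem_union_left _ hm
      · exact Finset.mem_union_right _ hn
      · exact Finset.union_subset_union (Finset.erase_subset _ _) (Finset.erase_subset _ _)
          (hsupp x hx)

/-- A walk visits a vertex cover `M` at least at every other step. -/
theorem SimpleGraph.Walk.length_add_one_le_two_mul_countP {V : Type*} [DecidableEq V]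
    {G : SimpleGraph V} (M : Finset V) (hcover : ∀ x y, G.Adj x y → x ∈ M ∨ y ∈ M)
    {u w : V} (p : G.Walk u w) :
    p.length + 1 ≤ 2 * p.support.countP (· ∈ M) + if u ∈ M then 0 else 1 := by
  induction p with
  | nil => simp only [length_nil, support_nil, List.countP_singleton]; split_ifs <;> simp_all
  | @cons u v w h p ih =>
    have := hcover u v h
    simp only [length_cons, support_cons, List.countP_cons, decide_eq_true_eq]
    split_ifs at ih ⊢ <;> first | omega | simp_all

/-- A path starting in a vertex cover `M` has at most `2 * M.card` vertices. -/
theorem SimpleGraph.Walk.IsPath.length_add_one_le_two_mul_card {V : Type*} [DecidableEq V]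
    {G : SimpleGraph V} (M : Finset V) (hcover : ∀ x y, G.Adj x y → x ∈ M ∨ y ∈ M)
    {u w : V} {p : G.Walk u w} (hp : p.IsPath) (hu : u ∈ M) :
    p.length + 1 ≤ 2 * M.card := by
  have hlen := p.length_add_one_le_two_mul_countP M hcover
  have hcount : p.support.countP (· ∈ M) ≤ M.card := by
    rw [List.countP_eq_length_filter, ← List.toFinset_card_of_nodup (hp.support_nodup.filter _)]
    exact Finset.card_le_card fun x hx => by simp_all
  rw [if_pos hu] at hlen
  omega

/-- if V(G) is partitioned into M, N with |M| = k, |N| ≥ k, all M–N edges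
present and N independent, then every vertex of M is an endpoint of a path on 2k
vertices, and no path on more than 2k vertices has an endpoint in M. -/
theorem stmt9 {V : Type*} [Fintype V] [DecidableEq V] (G : SimpleGraph V)
    (k : ℕ) (hk : 1 ≤ k) (M N : Finset V)
    (hpart : M ∪ N = Finset.univ) (hdisj : Disjoint M N)
    (hM : M.card = k) (hN : k ≤ N.card)
    (hadj : ∀ m ∈ M, ∀ n ∈ N, G.Adj m n)
    (hind : ∀ x ∈ N, ∀ y ∈ N, ¬ G.Adj x y) :
    (∀ m ∈ M, IsPathEndpoint G m (2 * k)) ∧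
    (∀ m ∈ M, ∀ n : ℕ, IsPathEndpoint G m n → n ≤ 2 * k) := by
  subst hM
  refine ⟨fun m hm => ?_, ?_⟩
  · obtain ⟨k, hk'⟩ := Nat.exists_eq_add_of_le' hk
    obtain ⟨w, p, hp, hlen, -⟩ :=
      exists_isPath_of_complete_between G k M N hdisj hk' (hk' ▸ hN) hadj m hm
    exact ⟨w, p, hp, hk' ▸ hlen⟩
  · rintro m hm n ⟨w, p, hp, rfl⟩
    refine hp.length_add_one_le_two_mul_card M (fun x y hxy => ?_) hm
    have hx : x ∈ M ∪ N := hpart ▸ Finset.mem_univ x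
    have hy : y ∈ M ∪ N := hpart ▸ Finset.mem_univ y
    rw [Finset.mem_union] at hx hy
    by_contra! h
    exact hind x (hx.resolve_left h.1) y (hy.resolve_left h.2) hxy
end

section
/- Let 4 ≤ k < ℓ and r = ℓ + ⌊k/2⌋ − 2, and consider a red/blue coloring of the complete graph K_r of the following form (a Type 1 coloring): the vertex set is partitioned into A and B with |A| = ⌊k/2⌋ − 1 and |B| = ℓ − 1, every edge inside B is blue, every edge between A and B is red, and edges inside A are colored arbitrarily. Then: (1) every vertex of B is a strict endpoint of a blue P_{ℓ−1}; (2) every vertex of B is a strict endpoint of a red P_{k−1} if k is even, and of a red P_{k−2} if k is odd; (3) every vertex of A is a strict endpoint of a red P_{k−2} if k is even, and of a red P_{k−3} if k is odd. -/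
section PathEndpoints

variable {V : Type*} {G : SimpleGraph V}

/-- Prepending an edge to a path that avoids the new endpoint. -/
theorem exists_isPath_cons {u v : V} {m : ℕ} {S T : Finset V} (h : G.Adj u v) (hu : u ∈ T)
    (huS : u ∉ S) (hST : S ⊆ T)
    (hv : ∃ (w : V) (p : G.Walk v w), p.IsPath ∧ p.length = m ∧ ∀ x ∈ p.support, x ∈ S) :
    ∃ (w : V) (p : G.Walk u w), p.IsPath ∧ p.length = m + 1 ∧ ∀ x ∈ p.support, x ∈ T := by
  obtain ⟨w, p, hp, hlen, hsupp⟩ := hv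
  refine ⟨w, .cons h p, hp.cons fun hmem => huS (hsupp u hmem), by simp [hlen], fun x hx => ?_⟩
  rw [SimpleGraph.Walk.support_cons, List.mem_cons] at hx
  rcases hx with rfl | hx
  · exact hu
  · exact hST (hsupp x hx)

/-- In a complete bipartite graph, alternating paths exist as long as the parts suffice. -/
theorem exists_alternating_isPath [DecidableEq V] (m : ℕ) :
    ∀ {S T : Finset V}, Disjoint S T → (∀ s ∈ S, ∀ t ∈ T, G.Adj s t) → ∀ {s : V}, s ∈ S →
    m / 2 + 1 ≤ S.card → (m + 1) / 2 ≤ T.card →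
    ∃ (w : V) (p : G.Walk s w), p.IsPath ∧ p.length = m ∧ ∀ x ∈ p.support, x ∈ S ∪ T := by
  induction m with
  | zero =>
    intro S T _ _ s hs _ _
    exact ⟨s, .nil, by simp, by simp, by simp [hs]⟩
  | succ m ih =>
    intro S T hdisj hadj s hs hS hT
    obtain ⟨t, ht⟩ : T.Nonempty := Finset.card_pos.mp (by omega)
    have hcard := Finset.card_erase_of_mem hs
    refine exists_isPath_cons (S := T ∪ S.erase s) (hadj s hs t ht)
      (Finset.mem_union_left _ hs) ?_ ?_
      (ih (hdisj.symm.mono_right (Finset.erase_subset _ _)) ?_ ht (by omega) (by omega))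
    · simpa using Finset.disjoint_left.mp hdisj hs
    · rw [Finset.union_comm]
      exact Finset.union_subset_union_left (Finset.erase_subset _ _)
    · exact fun x hx y hy => (hadj y (Finset.mem_of_mem_erase hy) x hx).symm

theorem SimpleGraph.IsClique.exists_isPath [DecidableEq V] (m : ℕ) :
    ∀ {S : Finset V}, G.IsClique S → ∀ {s : V}, s ∈ S → m + 1 ≤ S.card →
    ∃ (w : V) (p : G.Walk s w), p.IsPath ∧ p.length = m ∧ ∀ x ∈ p.support, x ∈ S := by
  induction m with
  | zero =>
    intro S _ s hs _
    exact ⟨s, .nil, by simp, by simp, by simp [hs]⟩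
  | succ m ih =>
    intro S hS s hs hcard
    have herase := Finset.card_erase_of_mem hs
    obtain ⟨t, ht⟩ : (S.erase s).Nonempty := Finset.card_pos.mp (by omega)
    exact exists_isPath_cons
      (hS hs (Finset.mem_of_mem_erase ht) (Finset.ne_of_mem_erase ht).symm) hs
      (Finset.notMem_erase _ _) (Finset.erase_subset _ _)
      (ih (hS.subset (Finset.coe_subset.mpr (Finset.erase_subset _ _))) ht (by omega))

theorem List.Nodup.length_le_card_of_subset [DecidableEq V] {l : List V} (hl : l.Nodup)
    {S : Finset V} (hS : ∀ x ∈ l, x ∈ S) : l.length ≤ S.card := by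
  rw [← List.toFinset_card_of_nodup hl]
  exact Finset.card_le_card fun x hx => hS x (List.mem_toFinset.mp hx)

/-- On a walk, every vertex of an independent set, except possibly the first one, is preceded by
a vertex outside of that set. -/
theorem SimpleGraph.Walk.countP_mem_le_of_independent [DecidableEq V] {B : Finset V}
    (hB : ∀ x ∈ B, ∀ y ∈ B, ¬ G.Adj x y) {v w : V} (p : G.Walk v w) :
    p.support.countP (· ∈ B) ≤ p.support.countP (· ∉ B) + if v ∈ B then 1 else 0 := by
  induction p with
  | nil => simp [List.countP_cons]
  | @cons u v w h p ih =>
    rw [SimpleGraph.Walk.support_cons, List.countP_cons, List.countP_cons]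
    by_cases hu : u ∈ B
    · have hv : v ∉ B := fun hv => hB u hu v hv h
      simp only [hu, hv, decide_true, decide_false, not_true_eq_false, if_true, if_false] at ih ⊢
      simpa using ih
    · have : (if v ∈ B then 1 else 0) ≤ 1 := by split <;> omega
      simp only [hu, decide_true, decide_false, not_false_eq_true, if_true]
      simp only [Bool.false_eq_true, if_false]
      omega

theorem SimpleGraph.Walk.IsPath.length_add_one_le_of_independent [DecidableEq V]
    {A B : Finset V}
    (hAB : ∀ x, x ∈ A ∨ x ∈ B) (hB : ∀ x ∈ B, ∀ y ∈ B, ¬ G.Adj x y) {v w : V}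
    {p : G.Walk v w} (hp : p.IsPath) :
    p.length + 1 ≤ 2 * A.card + if v ∈ B then 1 else 0 := by
  have hle := p.countP_mem_le_of_independent hB
  have hsum := p.support.length_eq_countP_add_countP (· ∈ B)
  have hA : p.support.countP (· ∉ B) ≤ A.card := by
    rw [List.countP_eq_length_filter]
    refine (hp.support_nodup.filter _).length_le_card_of_subset fun x hx => ?_
    have hxB : x ∉ B := by simpa using (List.mem_filter.mp hx).2
    exact (hAB x).resolve_right hxB
  rw [SimpleGraph.Walk.length_support] at hsum
  simp only [decide_eq_true_eq] at hsum
  omega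

theorem SimpleGraph.Walk.mem_of_mem_support_of_closed {B : Set V}
    (hB : ∀ x ∈ B, ∀ y, G.Adj x y → y ∈ B) {v w : V} (p : G.Walk v w) (hv : v ∈ B) :
    ∀ x ∈ p.support, x ∈ B := by
  induction p with
  | nil => simpa using hv
  | cons h p ih =>
    intro x hx
    rw [SimpleGraph.Walk.support_cons, List.mem_cons] at hx
    rcases hx with rfl | hx
    · exact hv
    · exact ih (hB _ hv _ h) x hx

end PathEndpoints

/-- properties of Type 1 (P_k, P_ℓ)-good colorings of K_r,
r = ℓ + ⌊k/2⌋ − 2, for 4 ≤ k < ℓ.  The red subgraph is R; blue is ⊤ \ R. -/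
theorem stmt11 (k ℓ : ℕ) (hk : 4 ≤ k) (hkl : k < ℓ)
    (A B : Finset (Fin (ℓ + k / 2 - 2)))
    (hpart : A ∪ B = Finset.univ) (hdisj : Disjoint A B)
    (hA : A.card = k / 2 - 1) (hB : B.card = ℓ - 1)
    (R : SimpleGraph (Fin (ℓ + k / 2 - 2)))
    (hAB : ∀ a ∈ A, ∀ b ∈ B, R.Adj a b)
    (hBB : ∀ x ∈ B, ∀ y ∈ B, ¬ R.Adj x y) :
    (∀ b ∈ B, StrictEndpoint (⊤ \ R) b (ℓ - 1)) ∧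
    (∀ b ∈ B, StrictEndpoint R b (if Even k then k - 1 else k - 2)) ∧
    (∀ a ∈ A, StrictEndpoint R a (if Even k then k - 2 else k - 3)) := by
  have hcover : ∀ x, x ∈ A ∨ x ∈ B := fun x => by
    rw [← Finset.mem_union, hpart]
    exact Finset.mem_univ x
  refine ⟨fun b hb => ⟨?_, ?_⟩, fun b hb => ⟨?_, ?_⟩, fun a ha => ⟨?_, ?_⟩⟩
  · have hclique : (⊤ \ R).IsClique (B : Set _) := fun x hx y hy hxy => by
      simpa [SimpleGraph.sdiff_adj, hxy] using hBB x hx y hy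
    obtain ⟨w, p, hp, hlen, -⟩ := hclique.exists_isPath (ℓ - 2) hb (by omega)
    exact ⟨w, p, hp, by omega⟩
  · rintro y ⟨w, p, hp, rfl⟩
    have hclosed : ∀ x ∈ (B : Set _), ∀ y, (⊤ \ R).Adj x y → y ∈ (B : Set _) := by
      intro x hx y hxy
      exact (hcover y).resolve_left fun hy => hxy.2 (hAB y hy x hx).symm
    have hle := hp.support_nodup.length_le_card_of_subset (S := B)
      (p.mem_of_mem_support_of_closed hclosed hb)
    rwa [SimpleGraph.Walk.length_support, hB] at hle
  · obtain ⟨w, p, hp, hlen, -⟩ := exists_alternating_isPath (G := R) (2 * A.card) hdisj.symm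
      (fun x hx y hy => (hAB y hy x hx).symm) hb (by omega) (by omega)
    refine ⟨w, p, hp, ?_⟩
    split_ifs with h <;> grind
  · rintro y ⟨w, p, hp, rfl⟩
    have hle := hp.length_add_one_le_of_independent hcover hBB
    rw [if_pos hb] at hle
    split_ifs with h <;> grind
  · obtain ⟨w, p, hp, hlen, -⟩ := exists_alternating_isPath (G := R) (2 * A.card - 1) hdisj
      hAB ha (by omega) (by omega)
    refine ⟨w, p, hp, ?_⟩
    split_ifs with h <;> grind
  · rintro y ⟨w, p, hp, rfl⟩
    have hle := hp.length_add_one_le_of_independent hcover hBB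
    rw [if_neg (Finset.disjoint_left.mp hdisj ha)] at hle
    split_ifs with h <;> grind
end

section
/- Let k be odd with 5 ≤ k < ℓ and r = ℓ + ⌊k/2⌋ − 2, and consider a red/blue coloring of the complete graph K_r of the following form (a Type 2 coloring): the vertex set is partitioned into A and B with |A| = ⌊k/2⌋ − 1 and |B| = ℓ − 1, one distinguished edge b inside B is red, every other edge inside B is blue, every edge between A and B is red, and edges inside A are colored arbitrarily. Then: (1) every vertex of B is a strict endpoint of a blue P_{ℓ−1}; (2) every vertex of B is a strict endpoint of a red P_{k−1}; (3) every vertex of A is a strict endpoint of a red P_{k−2}. -/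
section

variable {V : Type*}

theorem isPathEndpoint_of_isChain {G : SimpleGraph V} {v : V} {l : List V} {n : ℕ}
    (hc : (v :: l).IsChain G.Adj) (hn : (v :: l).Nodup) (hl : l.length + 1 = n) :
    IsPathEndpoint G v n := by
  have hs := SimpleGraph.Walk.support_ofSupport (List.cons_ne_nil v l) hc
  have hp : (SimpleGraph.Walk.ofSupport (v :: l) (List.cons_ne_nil v l) hc).IsPath := by
    rwa [SimpleGraph.Walk.isPath_def, hs]
  exact ⟨_, _, hp, (SimpleGraph.Walk.length_support _).symm.trans ((congrArg _ hs).trans hl)⟩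

theorem List.Nodup.countP_mem_le_card [DecidableEq V] {l : List V} (hl : l.Nodup)
    (S : Finset V) : l.countP (· ∈ S) ≤ S.card := by
  rw [List.countP_eq_length_filter, ← List.toFinset_card_of_nodup (hl.filter _)]
  exact Finset.card_le_card fun x hx => by simpa using (List.mem_filter.1 (List.mem_toFinset.1 hx)).2

/-- A path starting in a vertex set closed under adjacency stays in that set. -/
theorem SimpleGraph.Walk.support_subset_of_closed {G : SimpleGraph V} {S : Finset V}
    (h : ∀ x ∈ S, ∀ y, G.Adj x y → y ∈ S) {u w : V} (p : G.Walk u w) (hu : u ∈ S) :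
    ∀ x ∈ p.support, x ∈ S := by
  induction p with
  | nil => simpa using hu
  | cons hadj p ih =>
    intro x hx
    rw [SimpleGraph.Walk.support_cons, List.mem_cons] at hx
    rcases hx with rfl | hx
    · exact hu
    · exact ih (h _ hu _ hadj) x hx

/-- If the only edge inside the complement of `A` is `b₁b₂`, then along a path the vertices
outside `A` outnumber those in `A` by at most one for the start and one for `b₁b₂`. -/
theorem SimpleGraph.Walk.IsPath.countP_notMem_le [DecidableEq V] {G : SimpleGraph V}
    {A : Finset V} {b₁ b₂ : V}
    (h : ∀ x ∉ A, ∀ y ∉ A, G.Adj x y → (x = b₁ ∧ y = b₂) ∨ (x = b₂ ∧ y = b₁))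
    {u w : V} {p : G.Walk u w} (hp : p.IsPath) :
    p.support.countP (· ∉ A) ≤ p.support.countP (· ∈ A) + (if u ∈ A then 0 else 1) +
      (if b₁ ∈ p.support ∧ b₂ ∈ p.support then 1 else 0) := by
  induction p with
  | nil => simp [List.countP_cons]; split_ifs <;> omega
  | @cons u v w hadj p ih =>
    rw [SimpleGraph.Walk.cons_isPath_iff] at hp
    have ih := ih hp.1
    have hv : v ∈ p.support := p.start_mem_support
    simp only [SimpleGraph.Walk.support_cons, List.countP_cons, List.mem_cons]
    have key : u ∉ A → v ∉ A → ¬ (b₁ ∈ p.support ∧ b₂ ∈ p.support) ∧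
        ((b₁ = u ∨ b₁ ∈ p.support) ∧ (b₂ = u ∨ b₂ ∈ p.support)) := by
      intro hu hv'
      rcases h u hu v hv' hadj with ⟨rfl, rfl⟩ | ⟨rfl, rfl⟩ <;> tauto
    have mono : b₁ ∈ p.support ∧ b₂ ∈ p.support →
        (b₁ = u ∨ b₁ ∈ p.support) ∧ (b₂ = u ∨ b₂ ∈ p.support) := by tauto
    by_cases hu : u ∈ A <;> by_cases hvA : v ∈ A <;> simp only [hu, hvA] at ih key ⊢ <;>
      split_ifs at ih ⊢ <;> simp_all <;> omega

theorem SimpleGraph.Walk.IsPath.length_add_one_le [DecidableEq V] {G : SimpleGraph V}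
    {A : Finset V} {b₁ b₂ : V}
    (h : ∀ x ∉ A, ∀ y ∉ A, G.Adj x y → (x = b₁ ∧ y = b₂) ∨ (x = b₂ ∧ y = b₁))
    {u w : V} {p : G.Walk u w} (hp : p.IsPath) :
    p.length + 1 ≤ 2 * A.card + (if u ∈ A then 0 else 1) + 1 := by
  have h₁ := hp.countP_notMem_le h
  have h₂ := hp.support_nodup.countP_mem_le_card A
  have h₃ := List.length_eq_countP_add_countP (· ∈ A) (l := p.support)
  rw [p.length_support] at h₃
  simp only [decide_eq_true_eq] at h₃
  split_ifs at h₁ ⊢ <;> omega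

/-- In a graph complete between `A` and `B ∪ {v}`, an alternating path from `v` covers `A`. -/
theorem exists_alternating_isChain [DecidableEq V] (G : SimpleGraph V) (A : Finset V) :
    ∀ (B : Finset V) (v : V), Disjoint A B → A.card ≤ B.card → v ∉ A → v ∉ B →
      (∀ a ∈ A, ∀ b ∈ B, G.Adj a b) → (∀ a ∈ A, G.Adj v a) →
      ∃ l : List V, (v :: l).IsChain G.Adj ∧ (v :: l).Nodup ∧ l.length = 2 * A.card ∧
        ∀ x ∈ l, x ∈ A ∪ B := by
  induction A using Finset.induction_on with
  | empty => exact fun B v _ _ _ _ _ _ => ⟨[], by simp⟩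
  | insert a A ha ih =>
    intro B v hd hc hvA hvB hAB hv
    rw [Finset.card_insert_of_notMem ha] at hc ⊢
    obtain ⟨b, hb⟩ : B.Nonempty := Finset.card_pos.1 (by omega)
    rw [Finset.disjoint_insert_left] at hd
    have hbA : b ∉ A := Finset.disjoint_right.1 hd.2 hb
    obtain ⟨l, hl, hn, hlen, hsub⟩ := ih (B.erase b) b
      (hd.2.mono_right (Finset.erase_subset _ _))
      (by rw [Finset.card_erase_of_mem hb]; omega) hbA (Finset.notMem_erase _ _)
      (fun x hx y hy => hAB x (Finset.mem_insert_of_mem hx) y (Finset.mem_of_mem_erase hy))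
      (fun x hx => (hAB x (Finset.mem_insert_of_mem hx) b hb).symm)
    have hsub' : ∀ x ∈ l, x ∈ A ∨ (x ≠ b ∧ x ∈ B) := by simpa using hsub
    have hab := hAB a (Finset.mem_insert_self _ _) b hb
    have hva := hv a (Finset.mem_insert_self _ _)
    refine ⟨a :: b :: l, ?_, ?_, by simp [hlen]; ring, ?_⟩
    · simp only [List.isChain_cons_cons]
      exact ⟨hva, hab, hl⟩
    · rw [Finset.mem_insert] at hvA
      rw [List.nodup_cons, List.nodup_cons]
      simp only [List.mem_cons]
      refine ⟨?_, ?_, hn⟩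
      · rintro (rfl | rfl | h)
        · tauto
        · tauto
        · have := hsub' _ h; tauto
      · rintro (rfl | h)
        · tauto
        · have := hsub' _ h; tauto
    · intro x hx
      simp only [List.mem_cons] at hx
      simp only [Finset.mem_union, Finset.mem_insert]
      rcases hx with rfl | rfl | hx
      · tauto
      · tauto
      · have := hsub' _ hx; tauto

/-- In a graph complete on `B` up to the edge `b₁b₂`, every vertex of `B` starts a path
covering `B`. -/
theorem isPathEndpoint_card_of_almost_clique [DecidableEq V] {G : SimpleGraph V} {B : Finset V}
    {b₁ b₂ : V} (hb₁ : b₁ ∈ B) (hb₂ : b₂ ∈ B) (hbne : b₁ ≠ b₂) (hcard : 4 ≤ B.card)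
    (h : ∀ x ∈ B, ∀ y ∈ B, x ≠ y → ¬ ((x = b₁ ∧ y = b₂) ∨ (x = b₂ ∧ y = b₁)) → G.Adj x y)
    {b : V} (hb : b ∈ B) : IsPathEndpoint G b B.card := by
  wlog hbb : b ≠ b₂ generalizing b₁ b₂
  · rw [not_not] at hbb
    exact this hb₂ hb₁ hbne.symm (fun x hx y hy hxy hn => h x hx y hy hxy (by tauto))
      (hbb ▸ hbne.symm)
  obtain ⟨c, hc⟩ : (B \ {b, b₁, b₂}).Nonempty := by
    refine Finset.card_pos.1 ?_
    have h₁ := Finset.le_card_sdiff {b, b₁, b₂} B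
    have h₂ := Finset.card_le_three (a := b) (b := b₁) (c := b₂)
    omega
  simp only [Finset.mem_sdiff, Finset.mem_insert, Finset.mem_singleton, not_or] at hc
  obtain ⟨hcB, hcb, hc₁, hc₂⟩ := hc
  set S := B \ {b, c, b₂} with hS
  have hmem : ∀ x, x ∈ S ↔ x ∈ B ∧ x ≠ b ∧ x ≠ c ∧ x ≠ b₂ := by simp [hS]
  have hScard : S.card + 3 = B.card := by
    have h₃ : ({b, c, b₂} : Finset V).card = 3 :=
      Finset.card_eq_three.2 ⟨b, c, b₂, Ne.symm hcb, hbb, hc₂, rfl⟩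
    rw [← h₃]
    refine Finset.card_sdiff_add_card_eq_card ?_
    simp [Finset.insert_subset_iff, hb, hcB, hb₂]
  have hnodup : (b :: S.toList ++ [c]).Nodup := by
    simp [List.nodup_append, Finset.nodup_toList, hmem, Ne.symm hcb]
    tauto
  have hsub : ∀ x ∈ b :: S.toList ++ [c], x ∈ B ∧ x ≠ b₂ := by
    intro x hx
    simp only [List.cons_append, List.mem_cons, List.mem_append, Finset.mem_toList, hmem,
      List.not_mem_nil, or_false] at hx
    rcases hx with rfl | hx | rfl <;> tauto
  have hpair : (b :: S.toList ++ [c]).Pairwise G.Adj := by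
    refine hnodup.imp_of_mem fun {x y} hx hy hxy => ?_
    have hx := hsub x hx
    have hy := hsub y hy
    exact h x hx.1 y hy.1 hxy (by tauto)
  refine isPathEndpoint_of_isChain (l := S.toList ++ [c] ++ [b₂]) ?_ ?_ ?_
  · refine List.isChain_append (l₁ := b :: (S.toList ++ [c])).2
      ⟨hpair.isChain, List.isChain_singleton b₂, ?_⟩
    intro x hx y hy
    rw [← List.cons_append, List.getLast?_concat, Option.mem_some_iff] at hx
    obtain rfl : b₂ = y := by simpa using hy
    subst hx
    exact h _ hcB _ hb₂ hc₂ (by tauto)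
  · refine List.nodup_append (l₁ := b :: (S.toList ++ [c])).2
      ⟨hnodup, List.nodup_singleton _, ?_⟩
    intro x hx y hy
    obtain rfl : y = b₂ := by simpa using hy
    exact (hsub x hx).2
  · simp only [List.length_append, Finset.length_toList, List.length_singleton]
    omega

/-- In a graph complete between `A` and `B`, an edge `b₁b₂` inside `B` starts a path that
covers `A` and alternates from `b₂` on, avoiding a prescribed set `C`. -/
theorem exists_alternating_isChain_through_edge [DecidableEq V] {G : SimpleGraph V}
    {A B C : Finset V} {b₁ b₂ : V} (hd : Disjoint A B) (hb₁ : b₁ ∈ B) (hb₂ : b₂ ∈ B)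
    (h₁₂ : G.Adj b₁ b₂) (hAB : ∀ a ∈ A, ∀ b ∈ B, G.Adj a b)
    (hcard : A.card + C.card + 2 ≤ B.card) (hC₁ : b₁ ∉ C) (hC₂ : b₂ ∉ C) (hAC : Disjoint A C) :
    ∃ l : List V, (b₁ :: l).IsChain G.Adj ∧ (b₁ :: l).Nodup ∧ l.length = 2 * A.card + 1 ∧
      ∀ x ∈ b₁ :: l, x ∈ A ∪ B ∧ x ∉ C := by
  have hle : A.card ≤ (B \ (insert b₁ (insert b₂ C))).card := by
    have h₁ := Finset.le_card_sdiff (insert b₁ (insert b₂ C)) B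
    have h₂ := Finset.card_insert_le b₁ (insert b₂ C)
    have h₃ := Finset.card_insert_le b₂ C
    omega
  have hb₁A := Finset.disjoint_right.1 hd hb₁
  have hb₂A := Finset.disjoint_right.1 hd hb₂
  obtain ⟨l, hl, hn, hlen, hsub⟩ := exists_alternating_isChain G A _ b₂
    (hd.mono_right Finset.sdiff_subset) hle hb₂A (by simp)
    (fun a ha b hb => hAB a ha b (Finset.sdiff_subset hb)) (fun a ha => (hAB a ha b₂ hb₂).symm)
  simp only [Finset.mem_union, Finset.mem_sdiff, Finset.mem_insert, not_or] at hsub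
  refine ⟨b₂ :: l, ?_, ?_, by simp [hlen], ?_⟩
  · rw [List.isChain_cons_cons]
    exact ⟨h₁₂, hl⟩
  · rw [List.nodup_cons, List.mem_cons]
    refine ⟨?_, hn⟩
    rintro (h | h)
    · exact h₁₂.ne h
    · have := hsub _ h
      tauto
  · intro x hx
    simp only [List.mem_cons] at hx
    rw [Finset.mem_union]
    rcases hx with rfl | rfl | hx
    · exact ⟨Or.inr hb₁, hC₁⟩
    · exact ⟨Or.inr hb₂, hC₂⟩
    · have h₁ := hsub x hx
      have h₂ : x ∈ A → x ∉ C := fun h => Finset.disjoint_left.1 hAC h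
      tauto

theorem isPathEndpoint_left [DecidableEq V] {G : SimpleGraph V} {A B : Finset V} {b₁ b₂ : V}
    (hd : Disjoint A B) (hb₁ : b₁ ∈ B) (hb₂ : b₂ ∈ B) (h₁₂ : G.Adj b₁ b₂)
    (hAB : ∀ a ∈ A, ∀ b ∈ B, G.Adj a b) (hcard : A.card + 1 ≤ B.card) {a : V} (ha : a ∈ A) :
    IsPathEndpoint G a (2 * A.card + 1) := by
  have hpos : 0 < A.card := Finset.card_pos.2 ⟨a, ha⟩
  have hcA := Finset.card_erase_of_mem ha
  have haB := Finset.disjoint_left.1 hd ha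
  obtain ⟨l, hl, hn, hlen, hsub⟩ := exists_alternating_isChain_through_edge (C := ∅)
    (hd.mono_left (Finset.erase_subset a A)) hb₁ hb₂ h₁₂
    (fun x hx => hAB x (Finset.mem_of_mem_erase hx)) (by rw [Finset.card_empty]; omega)
    (by simp) (by simp) (by simp)
  refine isPathEndpoint_of_isChain (l := b₁ :: l) ?_ ?_ (by rw [List.length_cons]; omega)
  · exact List.isChain_cons_cons.2 ⟨hAB a ha b₁ hb₁, hl⟩
  · refine List.nodup_cons.2 ⟨fun h => ?_, hn⟩
    have := hsub a h
    simp [haB] at this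

theorem isPathEndpoint_right [DecidableEq V] {G : SimpleGraph V} {A B : Finset V} {b₁ b₂ : V}
    (hd : Disjoint A B) (hb₁ : b₁ ∈ B) (hb₂ : b₂ ∈ B) (h₁₂ : G.Adj b₁ b₂)
    (hAB : ∀ a ∈ A, ∀ b ∈ B, G.Adj a b) (hA : A.Nonempty) (hcard : A.card + 2 ≤ B.card)
    {b : V} (hb : b ∈ B) : IsPathEndpoint G b (2 * A.card + 2) := by
  have start : ∀ c ∈ B, ∀ d ∈ B, G.Adj c d → IsPathEndpoint G c (2 * A.card + 2) := by
    intro c hc d hd' hcd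
    obtain ⟨l, hl, hn, hlen, -⟩ := exists_alternating_isChain_through_edge (C := ∅)
      hd hc hd' hcd hAB (by rw [Finset.card_empty]; omega) (by simp) (by simp) (by simp)
    exact isPathEndpoint_of_isChain hl hn (by omega)
  by_cases hbb₁ : b = b₁
  · exact hbb₁ ▸ start b₁ hb₁ b₂ hb₂ h₁₂
  by_cases hbb₂ : b = b₂
  · exact hbb₂ ▸ start b₂ hb₂ b₁ hb₁ h₁₂.symm
  obtain ⟨a, ha⟩ := hA
  have hpos : 0 < A.card := Finset.card_pos.2 ⟨a, ha⟩
  have hcA := Finset.card_erase_of_mem ha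
  have haB := Finset.disjoint_left.1 hd ha
  have hbA := Finset.disjoint_right.1 hd hb
  obtain ⟨l, hl, hn, hlen, hsub⟩ := exists_alternating_isChain_through_edge (C := {b})
    (hd.mono_left (Finset.erase_subset a A)) hb₁ hb₂ h₁₂
    (fun x hx => hAB x (Finset.mem_of_mem_erase hx)) (by rw [Finset.card_singleton]; omega)
    (by simpa using Ne.symm hbb₁) (by simpa using Ne.symm hbb₂) (by simp [hbA])
  refine isPathEndpoint_of_isChain (l := a :: b₁ :: l) ?_ ?_
    (by simp only [List.length_cons]; omega)
  · simp only [List.isChain_cons_cons]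
    exact ⟨(hAB a ha b hb).symm, hAB a ha b₁ hb₁, hl⟩
  · rw [List.nodup_cons, List.nodup_cons, List.mem_cons]
    refine ⟨?_, fun h => ?_, hn⟩
    · rintro (rfl | h)
      · exact hbA ha
      · simpa using (hsub b h).2
    · have := hsub a h
      simp [haB] at this

end

/-- properties of Type 2 (P_k, P_ℓ)-good colorings of K_r,
r = ℓ + ⌊k/2⌋ − 2, for odd k with 5 ≤ k < ℓ.  The red subgraph is R; the
distinguished red edge inside B is (b₁, b₂). -/
theorem stmt12 (k ℓ : ℕ) (hodd : Odd k) (hk : 5 ≤ k) (hkl : k < ℓ)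
    (A B : Finset (Fin (ℓ + k / 2 - 2)))
    (hpart : A ∪ B = Finset.univ) (hdisj : Disjoint A B)
    (hA : A.card = k / 2 - 1) (hB : B.card = ℓ - 1)
    (b₁ b₂ : Fin (ℓ + k / 2 - 2)) (hb₁ : b₁ ∈ B) (hb₂ : b₂ ∈ B) (hbne : b₁ ≠ b₂)
    (R : SimpleGraph (Fin (ℓ + k / 2 - 2)))
    (hAB : ∀ a ∈ A, ∀ b ∈ B, R.Adj a b)
    (hBB : ∀ x ∈ B, ∀ y ∈ B,
      (R.Adj x y ↔ (x = b₁ ∧ y = b₂) ∨ (x = b₂ ∧ y = b₁))) :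
    (∀ b ∈ B, StrictEndpoint (⊤ \ R) b (ℓ - 1)) ∧
    (∀ b ∈ B, StrictEndpoint R b (k - 1)) ∧
    (∀ a ∈ A, StrictEndpoint R a (k - 2)) := by
  obtain ⟨m, rfl⟩ := hodd
  have hBA : ∀ x, x ∉ A ↔ x ∈ B := fun x =>
    ⟨fun hx => (Finset.mem_union.1 (hpart ▸ Finset.mem_univ x)).resolve_left hx,
      fun hx => Finset.disjoint_right.1 hdisj hx⟩
  have h₁₂ : R.Adj b₁ b₂ := (hBB b₁ hb₁ b₂ hb₂).2 (Or.inl ⟨rfl, rfl⟩)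
  have hR : ∀ x ∉ A, ∀ y ∉ A, R.Adj x y → (x = b₁ ∧ y = b₂) ∨ (x = b₂ ∧ y = b₁) :=
    fun x hx y hy => (hBB x ((hBA x).1 hx) y ((hBA y).1 hy)).1
  refine ⟨fun b hb => ⟨?_, ?_⟩, fun b hb => ⟨?_, ?_⟩, fun a ha => ⟨?_, ?_⟩⟩
  · rw [← hB]
    refine isPathEndpoint_card_of_almost_clique hb₁ hb₂ hbne (by omega) ?_ hb
    intro x hx y hy hxy hn
    rw [SimpleGraph.sdiff_adj, SimpleGraph.top_adj, hBB x hx y hy]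
    exact ⟨hxy, hn⟩
  · rintro y ⟨w, p, hp, rfl⟩
    have hclosed : ∀ x ∈ B, ∀ y, (⊤ \ R).Adj x y → y ∈ B := by
      intro x hx y hxy
      rw [SimpleGraph.sdiff_adj] at hxy
      exact (hBA y).1 fun hy => hxy.2 (hAB y hy x hx).symm
    rw [← p.length_support, ← hB, ← List.toFinset_card_of_nodup hp.support_nodup]
    exact Finset.card_le_card fun x hx =>
      p.support_subset_of_closed hclosed hb x (List.mem_toFinset.1 hx)
  · convert isPathEndpoint_right hdisj hb₁ hb₂ h₁₂ hAB (Finset.card_pos.1 (by omega)) (by omega) hb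
      using 1
    omega
  · rintro y ⟨w, p, hp, rfl⟩
    have := hp.length_add_one_le hR
    rw [if_neg ((hBA b).2 hb)] at this
    omega
  · convert isPathEndpoint_left hdisj hb₁ hb₂ h₁₂ hAB (by omega) ha using 1
    omega
  · rintro y ⟨w, p, hp, rfl⟩
    have := hp.length_add_one_le hR
    rw [if_pos ha] at this
    omega
end

section
/- Let k ≥ 5 be odd, ℓ = k + 1, and r = ℓ + ⌊k/2⌋ − 2, and consider a red/blue coloring of the complete graph K_r of the following form (a Type 3 coloring): the vertex set is partitioned into A and B with |A| = ⌊ℓ/2⌋ − 1 and |B| = k − 1, every edge inside B is red, every edge between A and B is blue, and edges inside A are colored arbitrarily. Then: (1) every vertex of B is a strict endpoint of a red P_{k−1}; (2) every vertex of B is a strict endpoint of a blue P_{ℓ−1}; (3) every vertex of A is a strict endpoint of a blue P_{ℓ−2}. -/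
/-- A vertex of a clique `S` on `n + 1` vertices starts a path with `n` edges inside `S`. -/
theorem exists_isPath_of_clique {V : Type*} [DecidableEq V] (G : SimpleGraph V) (n : ℕ) :
    ∀ (S : Finset V) (v : V), v ∈ S → S.card = n + 1 →
      (∀ x ∈ S, ∀ y ∈ S, x ≠ y → G.Adj x y) →
      ∃ (w : V) (p : G.Walk v w), p.IsPath ∧ p.length = n ∧ ∀ x ∈ p.support, x ∈ S := by
  induction n with
  | zero =>
    intro S v hv _ _
    exact ⟨v, .nil, .nil, rfl, by simpa using hv⟩
  | succ n ih =>
    intro S v hv hS hadj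
    have hcard : (S.erase v).card = n + 1 := by rw [Finset.card_erase_of_mem hv]; omega
    obtain ⟨u, hu⟩ : (S.erase v).Nonempty := Finset.card_pos.1 (by omega)
    obtain ⟨w, p, hp, hlen, hsupp⟩ := ih (S.erase v) u hu hcard fun x hx y hy =>
      hadj x (Finset.mem_of_mem_erase hx) y (Finset.mem_of_mem_erase hy)
    have huv : G.Adj v u :=
      hadj v hv u (Finset.mem_of_mem_erase hu) (Finset.ne_of_mem_erase hu).symm
    refine ⟨w, .cons huv p, hp.cons fun h => Finset.notMem_erase v S (hsupp v h), by simp [hlen],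
      ?_⟩
    intro x hx
    rw [SimpleGraph.Walk.support_cons, List.mem_cons] at hx
    obtain rfl | hx := hx
    · exact hv
    · exact Finset.mem_of_mem_erase (hsupp x hx)

/-- If `S` and `T` are disjoint and completely joined, then a vertex of `S` starts a path with `n`
edges alternating between `S` and `T`, as long as `S` and `T` are large enough. -/
theorem exists_isPath_of_complete_bipartite {V : Type*} [DecidableEq V] (G : SimpleGraph V)
    (n : ℕ) :
    ∀ (S T : Finset V) (v : V), v ∈ S → Disjoint S T → n + 1 ≤ 2 * S.card → n ≤ 2 * T.card →
      (∀ x ∈ S, ∀ y ∈ T, G.Adj x y) →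
      ∃ (w : V) (p : G.Walk v w), p.IsPath ∧ p.length = n ∧ ∀ x ∈ p.support, x ∈ S ∪ T := by
  induction n with
  | zero =>
    intro S T v hv _ _ _ _
    exact ⟨v, .nil, .nil, rfl, by simp [hv]⟩
  | succ n ih =>
    intro S T v hv hST hS hT hadj
    have hcard : (S.erase v).card = S.card - 1 := Finset.card_erase_of_mem hv
    obtain ⟨u, hu⟩ : T.Nonempty := Finset.card_pos.1 (by omega)
    obtain ⟨w, p, hp, hlen, hsupp⟩ := ih T (S.erase v) u hu
      (hST.symm.mono_right (Finset.erase_subset v S)) (by omega) (by omega)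
      fun x hx y hy => (hadj y (Finset.mem_of_mem_erase hy) x hx).symm
    have hvT : v ∉ T := Finset.disjoint_left.1 hST hv
    refine ⟨w, .cons (hadj v hv u hu) p, hp.cons fun h => ?_, by simp [hlen], ?_⟩
    · simpa [hvT] using hsupp v h
    · intro x hx
      rw [SimpleGraph.Walk.support_cons, List.mem_cons] at hx
      obtain rfl | hx := hx
      · exact Finset.mem_union_left T hv
      · have := hsupp x hx
        simp only [Finset.mem_union, Finset.mem_erase] at this ⊢
        tauto

/-- A path all of whose vertices lie in `S` has at most `S.card` vertices. -/
theorem SimpleGraph.Walk.IsPath.length_lt_card_of_support_subset {V : Type*} [DecidableEq V]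
    {G : SimpleGraph V} {S : Finset V} {u v : V} {p : G.Walk u v} (hp : p.IsPath)
    (hsupp : ∀ x ∈ p.support, x ∈ S) : p.length + 1 ≤ S.card := by
  rw [← p.length_support, ← List.toFinset_card_of_nodup hp.support_nodup]
  exact Finset.card_le_card fun x hx => hsupp x (List.mem_toFinset.1 hx)

/-- A walk starting in a set closed under adjacency stays in that set. -/
theorem SimpleGraph.Walk.support_subset_of_adj_closed {V : Type*} {G : SimpleGraph V}
    {S : Finset V} (hS : ∀ x ∈ S, ∀ y, G.Adj x y → y ∈ S) {u v : V} (p : G.Walk u v)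
    (hu : u ∈ S) : ∀ x ∈ p.support, x ∈ S := by
  induction p with
  | nil => simpa using hu
  | cons h p ih =>
    simpa only [SimpleGraph.Walk.support_cons, List.forall_mem_cons] using
      ⟨hu, ih (hS _ hu _ h)⟩

/-- In a walk, at most every other vertex lies in an independent set `B`. -/
theorem SimpleGraph.Walk.length_succ_le_of_independent {V : Type*} [DecidableEq V]
    {G : SimpleGraph V} {B : Finset V} (hB : ∀ x ∈ B, ∀ y ∈ B, ¬ G.Adj x y) {u v : V}
    (p : G.Walk u v) :
    p.length + 1 ≤ 2 * (p.support.filter (· ∉ B)).length + if u ∈ B then 1 else 0 := by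
  induction p with
  | @nil u => by_cases hu : u ∈ B <;> simp [hu]
  | @cons u v w h p ih =>
    by_cases hu : u ∈ B
    · have hv : v ∉ B := fun hv => hB u hu v hv h
      simp [hu, hv] at ih ⊢
      omega
    · simp only [SimpleGraph.Walk.length_cons, SimpleGraph.Walk.support_cons, hu,
        not_false_eq_true, decide_true, List.filter_cons_of_pos, List.length_cons, if_false]
      split_ifs at ih <;> omega

/-- A path has at most twice as many vertices as there are outside an independent set `B`, plus one
if the path starts in `B`. -/
theorem SimpleGraph.Walk.IsPath.length_succ_le_of_independent {V : Type*} [DecidableEq V]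
    {G : SimpleGraph V} {A B : Finset V} (hAB : ∀ x, x ∉ B → x ∈ A)
    (hB : ∀ x ∈ B, ∀ y ∈ B, ¬ G.Adj x y) {u v : V} {p : G.Walk u v} (hp : p.IsPath) :
    p.length + 1 ≤ 2 * A.card + if u ∈ B then 1 else 0 := by
  have hle : (p.support.filter (· ∉ B)).length ≤ A.card := by
    rw [← List.toFinset_card_of_nodup (hp.support_nodup.filter _)]
    refine Finset.card_le_card fun x hx => hAB x ?_
    simpa using (List.mem_filter.1 (List.mem_toFinset.1 hx)).2
  have := p.length_succ_le_of_independent hB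
  omega

/-- properties of Type 3 (P_k, P_ℓ)-good colorings of K_r,
r = ℓ + ⌊k/2⌋ − 2, for odd k ≥ 5 and ℓ = k + 1.  The red subgraph is R. -/
theorem stmt13 (k ℓ : ℕ) (hodd : Odd k) (hk : 5 ≤ k) (hℓ : ℓ = k + 1)
    (A B : Finset (Fin (ℓ + k / 2 - 2)))
    (hpart : A ∪ B = Finset.univ) (hdisj : Disjoint A B)
    (hA : A.card = ℓ / 2 - 1) (hB : B.card = k - 1)
    (R : SimpleGraph (Fin (ℓ + k / 2 - 2)))
    (hBBred : ∀ x ∈ B, ∀ y ∈ B, x ≠ y → R.Adj x y)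
    (hABblue : ∀ a ∈ A, ∀ b ∈ B, ¬ R.Adj a b) :
    (∀ b ∈ B, StrictEndpoint R b (k - 1)) ∧
    (∀ b ∈ B, StrictEndpoint (⊤ \ R) b (ℓ - 1)) ∧
    (∀ a ∈ A, StrictEndpoint (⊤ \ R) a (ℓ - 2)) := by
  obtain ⟨m, rfl⟩ := hodd
  subst hℓ
  have hcover : ∀ x, x ∉ B → x ∈ A := fun x hx => by
    have : x ∈ A ∪ B := hpart ▸ Finset.mem_univ x
    exact (Finset.mem_union.1 this).resolve_right hx
  have hred : ∀ x ∈ B, ∀ y, R.Adj x y → y ∈ B := fun x hx y h => by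
    by_contra hy
    exact hABblue y (hcover y hy) x hx h.symm
  have hindep : ∀ x ∈ B, ∀ y ∈ B, ¬ (⊤ \ R).Adj x y := fun x hx y hy h => by
    rw [SimpleGraph.sdiff_adj, SimpleGraph.top_adj] at h
    exact h.2 (hBBred x hx y hy h.1)
  have hblue : ∀ a ∈ A, ∀ b ∈ B, (⊤ \ R).Adj a b := fun a ha b hb => by
    rw [SimpleGraph.sdiff_adj, SimpleGraph.top_adj]
    exact ⟨fun h => Finset.disjoint_left.1 hdisj ha (h ▸ hb), hABblue a ha b hb⟩
  refine ⟨fun b hb => ⟨?_, ?_⟩, fun b hb => ⟨?_, ?_⟩, fun a ha => ⟨?_, ?_⟩⟩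
  · obtain ⟨w, p, hp, hlen, -⟩ :=
      exists_isPath_of_clique R (2 * m - 1) B b hb (by omega) hBBred
    exact ⟨w, p, hp, by omega⟩
  · rintro y ⟨w, p, hp, rfl⟩
    rw [← hB]
    exact hp.length_lt_card_of_support_subset (p.support_subset_of_adj_closed hred hb)
  · obtain ⟨w, p, hp, hlen, -⟩ := exists_isPath_of_complete_bipartite (⊤ \ R) (2 * m) B A b hb
      hdisj.symm (by omega) (by omega) fun x hx y hy => (hblue y hy x hx).symm
    exact ⟨w, p, hp, by omega⟩
  · rintro y ⟨w, p, hp, rfl⟩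
    have := hp.length_succ_le_of_independent hcover hindep
    rw [if_pos hb] at this
    omega
  · obtain ⟨w, p, hp, hlen, -⟩ := exists_isPath_of_complete_bipartite (⊤ \ R) (2 * m - 1) A B a ha
      hdisj (by omega) (by omega) hblue
    exact ⟨w, p, hp, by omega⟩
  · rintro y ⟨w, p, hp, rfl⟩
    have := hp.length_succ_le_of_independent hcover hindep
    rw [if_neg (Finset.disjoint_left.1 hdisj ha)] at this
    omega
end

section
/- Let k ≥ 4 and r = k + ⌊k/2⌋ − 2, and consider a red/blue coloring of the complete graph K_r of the following form (a Type 1a coloring): the vertex set is partitioned into A and B with |A| = ⌊k/2⌋ − 1 and |B| = k − 1, every edge inside B is blue, every edge between A and B is red, and edges inside A are colored arbitrarily. Then: (1) every vertex of B is a strict endpoint of a blue P_{k−1}; (2) every vertex of B is a strict endpoint of a red P_{k−1} if k is even, and of a red P_{k−2} if k is odd; (3) every vertex of A is a strict endpoint of a red P_{k−2} if k is even, and of a red P_{k−3} if k is odd. -/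
/-- If all edges between the disjoint finsets `S ∋ v` and `T` are present in `G`, then `v` is an
endpoint of a path alternating between `S` and `T`, as long as the sizes of `S` and `T` permit. -/
lemma exists_alternating_path {V : Type*} [DecidableEq V] (G : SimpleGraph V) (n : ℕ) :
    ∀ (S T : Finset V) (v : V), v ∈ S → Disjoint S T → (∀ s ∈ S, ∀ t ∈ T, G.Adj s t) →
      (n + 2) / 2 ≤ S.card → (n + 1) / 2 ≤ T.card →
      ∃ (w : V) (p : G.Walk v w), p.IsPath ∧ p.length = n ∧ ∀ x ∈ p.support, x ∈ S ∪ T := by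
  induction n with
  | zero =>
    intro S T v hv _ _ _ _
    exact ⟨v, .nil, .nil, rfl, by simp [hv]⟩
  | succ n ih =>
    intro S T v hv hd hadj hS hT
    obtain ⟨w, hw⟩ : T.Nonempty := Finset.card_pos.mp (by omega)
    obtain ⟨z, p, hp, hlen, hsup⟩ := ih T (S.erase v) w hw
      (hd.symm.mono_right (Finset.erase_subset v S))
      (fun t ht s hs => (hadj s (Finset.mem_of_mem_erase hs) t ht).symm)
      (by omega) (by rw [Finset.card_erase_of_mem hv]; omega)
    refine ⟨z, .cons (hadj v hv w hw) p, hp.cons fun hmem => ?_, by simp [hlen], ?_⟩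
    · have := hsup v hmem
      simp [Finset.disjoint_left.mp hd hv] at this
    · intro x hx
      rw [SimpleGraph.Walk.support_cons, List.mem_cons] at hx
      rcases hx with rfl | hx
      · exact Finset.mem_union_left _ hv
      · have := hsup x hx
        simp only [Finset.mem_union, Finset.mem_erase] at this ⊢
        tauto

/-- Every vertex of a finite clique is an endpoint of a path through the whole clique. -/
lemma isPathEndpoint_card_of_isClique {V : Type*} [DecidableEq V] {G : SimpleGraph V}
    {B : Finset V} (hB : G.IsClique (B : Set V)) {b : V} (hb : b ∈ B) :
    IsPathEndpoint G b B.card := by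
  have hpos : 0 < B.card := Finset.card_pos.mpr ⟨b, hb⟩
  obtain ⟨S, hbS, hSB, hS⟩ := Finset.exists_subsuperset_card_eq
    (Finset.singleton_subset_iff.mpr hb) (n := (B.card + 1) / 2)
    (by rw [Finset.card_singleton]; omega) (by omega)
  have hT := Finset.card_sdiff_of_subset hSB
  obtain ⟨w, p, hp, hlen, -⟩ := exists_alternating_path G (B.card - 1) S (B \ S) b
    (Finset.singleton_subset_iff.mp hbS) Finset.disjoint_sdiff
    (fun s hs t ht => hB (hSB hs) (Finset.mem_sdiff.mp ht).1
      fun h => (Finset.mem_sdiff.mp ht).2 (h ▸ hs))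
    (by omega) (by omega)
  exact ⟨w, p, hp, by omega⟩

/-- A path starting in a finset that no edge leaves has at most as many vertices as the finset. -/
lemma le_card_of_isPathEndpoint {V : Type*} [DecidableEq V] {G : SimpleGraph V} {B : Finset V}
    (hB : ∀ x ∈ B, ∀ y, G.Adj x y → y ∈ B) {b : V} (hb : b ∈ B) {n : ℕ}
    (h : IsPathEndpoint G b n) : n ≤ B.card := by
  obtain ⟨w, p, hp, rfl⟩ := h
  have hsup : ∀ {u w : V} (q : G.Walk u w), u ∈ B → ∀ x ∈ q.support, x ∈ B := by
    intro u w q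
    induction q with
    | nil => simp
    | cons hadj q ih =>
      intro hu x hx
      rw [SimpleGraph.Walk.support_cons, List.mem_cons] at hx
      rcases hx with rfl | hx
      · exact hu
      · exact ih (hB _ hu _ hadj) x hx
  rw [← SimpleGraph.Walk.length_support, ← List.toFinset_card_of_nodup hp.support_nodup]
  exact Finset.card_le_card fun x hx => hsup p hb x (List.mem_toFinset.mp hx)

/-- If the complement of `A` is independent, a walk meets `A` in at least half of its vertices,
up to one extra vertex when it starts outside `A`. -/
lemma walk_length_le_of_cover {V : Type*} [DecidableEq V] {G : SimpleGraph V} {A : Finset V}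
    (hA : ∀ x ∉ A, ∀ y ∉ A, ¬ G.Adj x y) {u w : V} (p : G.Walk u w) :
    p.length + 1 ≤ 2 * (p.support.filter (· ∈ A)).length + if u ∈ A then 0 else 1 := by
  induction p with
  | @nil u => by_cases hu : u ∈ A <;> simp [hu]
  | @cons u v w hadj p ih =>
    rw [SimpleGraph.Walk.support_cons, SimpleGraph.Walk.length_cons, List.filter_cons]
    by_cases hu : u ∈ A
    · simp only [hu, decide_true, if_true, List.length_cons]
      split_ifs at ih <;> omega
    · have hv : v ∈ A := by
        by_contra hv
        exact hA u hu v hv hadj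
      simp only [hv, if_true] at ih
      simp [hu]
      omega

/-- If the complement of `A` is independent, a path has at most `2 * |A|` vertices,
or `2 * |A| + 1` when it starts outside `A`. -/
lemma le_of_isPathEndpoint_of_cover {V : Type*} [DecidableEq V] {G : SimpleGraph V}
    {A : Finset V} (hA : ∀ x ∉ A, ∀ y ∉ A, ¬ G.Adj x y) {v : V} {n : ℕ}
    (h : IsPathEndpoint G v n) : n ≤ 2 * A.card + if v ∈ A then 0 else 1 := by
  obtain ⟨w, p, hp, rfl⟩ := h
  have hcard : (p.support.filter (· ∈ A)).length ≤ A.card := by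
    rw [← List.toFinset_card_of_nodup (hp.support_nodup.filter _)]
    exact Finset.card_le_card fun x hx => by simpa using (List.mem_filter.mp
      (List.mem_toFinset.mp hx)).2
  exact (walk_length_le_of_cover hA p).trans (by omega)

/-- properties of Type 1a (P_k, P_k)-good colorings of K_r,
r = k + ⌊k/2⌋ − 2, for k ≥ 4.  The red subgraph is R; blue is ⊤ \ R. -/
theorem stmt14 (k : ℕ) (hk : 4 ≤ k)
    (A B : Finset (Fin (k + k / 2 - 2)))
    (hpart : A ∪ B = Finset.univ) (hdisj : Disjoint A B)
    (hA : A.card = k / 2 - 1) (hB : B.card = k - 1)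
    (R : SimpleGraph (Fin (k + k / 2 - 2)))
    (hAB : ∀ a ∈ A, ∀ b ∈ B, R.Adj a b)
    (hBB : ∀ x ∈ B, ∀ y ∈ B, ¬ R.Adj x y) :
    (∀ b ∈ B, StrictEndpoint (⊤ \ R) b (k - 1)) ∧
    (∀ b ∈ B, StrictEndpoint R b (if Even k then k - 1 else k - 2)) ∧
    (∀ a ∈ A, StrictEndpoint R a (if Even k then k - 2 else k - 3)) := by
  have hmem : ∀ x, x ∉ A → x ∈ B := fun x hx =>
    (Finset.mem_union.mp (hpart ▸ Finset.mem_univ x)).resolve_left hx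
  have hcover : ∀ x ∉ A, ∀ y ∉ A, ¬ R.Adj x y :=
    fun x hx y hy => hBB x (hmem x hx) y (hmem y hy)
  refine ⟨fun b hb => ?_, fun b hb => ?_, fun a ha => ?_⟩
  · rw [← hB]
    refine ⟨isPathEndpoint_card_of_isClique (fun x hx y hy hxy => ?_) hb,
      fun y => le_card_of_isPathEndpoint (fun x hx y hxy => hmem y fun hy => ?_) hb⟩
    · exact ⟨hxy, hBB x hx y hy⟩
    · exact hxy.2 (hAB y hy x hx).symm
  · have hval : (if Even k then k - 1 else k - 2) = 2 * A.card + 1 := by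
      simp only [Nat.even_iff]
      split_ifs <;> omega
    rw [hval]
    refine ⟨?_, fun y hy => ?_⟩
    · obtain ⟨w, p, hp, hlen, -⟩ := exists_alternating_path R (2 * A.card) B A b hb hdisj.symm
        (fun s hs t ht => (hAB t ht s hs).symm) (by omega) (by omega)
      exact ⟨w, p, hp, by omega⟩
    · simpa [Finset.disjoint_right.mp hdisj hb] using le_of_isPathEndpoint_of_cover hcover hy
  · have hval : (if Even k then k - 2 else k - 3) = 2 * A.card := by
      simp only [Nat.even_iff]
      split_ifs <;> omega
    rw [hval]
    refine ⟨?_, fun y hy => ?_⟩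
    · obtain ⟨w, p, hp, hlen, -⟩ := exists_alternating_path R (2 * A.card - 1) A B a ha hdisj
        hAB (by omega) (by omega)
      exact ⟨w, p, hp, by omega⟩
    · simpa [ha] using le_of_isPathEndpoint_of_cover hcover hy
end
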